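/- arXiv:0902.2771 — 3 statements merged into one kernel-verified Lean document; each statement's English description precedes it below -/
import Mathlib

section
/- For every number of players n and every size vector (m₁,…,m_n), the set of n-player games of size m₁×…×m_n having a unique correlated equilibrium is an open subset of the set of all games of size m₁×…×m_n. -/
/-- The set of pure strategy profiles of an `n`-player game in which
player `i` has `m i` pure strategies. -/
abbrev Strat {n : ℕ} (m : Fin n → ℕ) : Type := ∀ i, Fin (m i)

/-- An `n`-player game of size `m 0 × ⋯ × m (n-1)`: player `i`'s payoff function is `G i`.
The space of such games carries the (product, i.e. Euclidean) topology. -/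
abbrev Game {n : ℕ} (m : Fin n → ℕ) : Type := Fin n → Strat m → ℝ

/-- A correlated strategy: a probability distribution on pure strategy profiles. -/
def IsCorrStrat {n : ℕ} {m : Fin n → ℕ} (μ : Strat m → ℝ) : Prop :=
  (∀ s, 0 ≤ μ s) ∧ ∑ s, μ s = 1

/-- The incentive linear form
`h^{sᵢ,tᵢ}(μ) = ∑_{s : s i = sᵢ} μ s * (Uⁱ(s) - Uⁱ(tᵢ, s⁻ⁱ))`. -/
def hIC {n : ℕ} {m : Fin n → ℕ} (G : Game m) (i : Fin n) (si ti : Fin (m i))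
    (μ : Strat m → ℝ) : ℝ :=
  ∑ s : Strat m, if s i = si then μ s * (G i s - G i (Function.update s i ti)) else 0

/-- A correlated equilibrium: a correlated strategy satisfying all incentive constraints. -/
def IsCorrEq {n : ℕ} {m : Fin n → ℕ} (G : Game m) (μ : Strat m → ℝ) : Prop :=
  IsCorrStrat μ ∧ ∀ (i : Fin n) (si ti : Fin (m i)), 0 ≤ hIC G i si ti μ

section UCEsec
open Finset Topology Filter

namespace UCE

/-- Existence of stationary distributions. -/
lemma exists_stationary {k : ℕ} (hk : 0 < k) (a : Fin k → Fin k → ℝ) (ha : ∀ s t, 0 ≤ a s t) :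
    ∃ x : Fin k → ℝ, (∀ s, 0 ≤ x s) ∧ ∑ s, x s = 1 ∧
      ∀ g : Fin k → ℝ, ∑ s, x s * ∑ t, a s t * (g t - g s) = 0 := by
  let q : Matrix (Fin k) (Fin k) ℝ := fun s u => a s u - if s = u then ∑ t, a s t else 0
  have hq : ∀ (g : Fin k → ℝ) (s : Fin k), ∑ u, q s u * g u = ∑ t, a s t * (g t - g s) := by
    intro g s
    simp only [q, sub_mul, mul_sub, Finset.sum_sub_distrib, ite_mul, zero_mul, Finset.sum_ite_eq,
      Finset.mem_univ, if_true, Finset.sum_mul]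
  let Q : (Fin k → ℝ) →ₗ[ℝ] (Fin k → ℝ) := Matrix.vecMulLinear q
  have hQ : ∀ (x g : Fin k → ℝ), ∑ u, Q x u * g u = ∑ s, x s * ∑ t, a s t * (g t - g s) := by
    intro x g
    simp only [← hq]
    simp only [Q, Matrix.vecMulLinear_apply, Matrix.vecMul, dotProduct, Finset.sum_mul,
      Finset.mul_sum]
    rw [Finset.sum_comm]
    simp only [mul_assoc]
  by_cases h0 : (0 : Fin k → ℝ) ∈ Q '' stdSimplex ℝ (Fin k)
  · obtain ⟨x, hx, hx0⟩ := h0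
    refine ⟨x, hx.1, hx.2, fun g => ?_⟩
    rw [← hQ, hx0]; simp
  · exfalso
    have hc : IsCompact (Q '' stdSimplex ℝ (Fin k)) :=
      (isCompact_stdSimplex ℝ (Fin k)).image (LinearMap.continuous_of_finiteDimensional Q)
    obtain ⟨f, u, hu, hf⟩ := geometric_hahn_banach_point_closed
      ((convex_stdSimplex ℝ (Fin k)).linear_image Q) hc.isClosed h0
    rw [map_zero] at hu
    have : Nonempty (Fin k) := ⟨⟨0, hk⟩⟩
    let g : Fin k → ℝ := fun i => f (fun j => if i = j then 1 else 0)
    have hfg : ∀ x, f x = ∑ i, x i * g i := fun x => by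
      have := LinearMap.pi_apply_eq_sum_univ (f : (Fin k → ℝ) →ₗ[ℝ] ℝ) x
      simpa [g] using this
    obtain ⟨s, hs⟩ := Finite.exists_max g
    have h1 := hf (Q (Pi.single s 1)) ⟨_, single_mem_stdSimplex ℝ s, rfl⟩
    rw [hfg, hQ] at h1
    rw [Finset.sum_eq_single s (by intro b _ hb; simp [hb]) (by simp)] at h1
    have h2 : ∑ t, a s t * (g t - g s) ≤ 0 := Finset.sum_nonpos fun t _ =>
      mul_nonpos_of_nonneg_of_nonpos (ha s t) (by linarith [hs t])
    simp at h1
    simp only [mul_sub, Finset.sum_sub_distrib] at h1 h2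
    linarith

/-- Stiemke's lemma. -/
lemma stiemke {V J : Type*} [AddCommGroup V] [Module ℝ V] [Fintype J] [DecidableEq J]
    (L : V →ₗ[ℝ] (J → ℝ)) (hL : ∀ d, (∀ j, 0 ≤ L d j) → L d = 0) :
    ∃ a : J → ℝ, (∀ j, 0 < a j) ∧ ∀ d, ∑ j, a j * L d j = 0 := by
  have hdis : Disjoint (stdSimplex ℝ J) (LinearMap.range L : Set (J → ℝ)) := by
    rw [Set.disjoint_left]
    rintro _ hx ⟨d, rfl⟩
    have := hL d hx.1
    have h1 := hx.2
    rw [this] at h1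
    simp at h1
  obtain ⟨f, u, v, hu, huv, hv⟩ := geometric_hahn_banach_compact_closed (convex_stdSimplex ℝ J)
    (isCompact_stdSimplex ℝ J) (LinearMap.range L).convex
    (Submodule.closed_of_finiteDimensional (LinearMap.range L)) hdis
  have hz : ∀ d, f (L d) = 0 := by
    intro d
    by_contra hne
    have := hv (L (((v - 1) / f (L d)) • d)) ⟨_, rfl⟩
    rw [map_smul, map_smul, smul_eq_mul, div_mul_cancel₀ _ hne] at this
    linarith
  have hv0 : v < 0 := by simpa using hv 0 ⟨0, by simp⟩
  refine ⟨fun j => - f (fun i => if j = i then 1 else 0), fun j => ?_, fun d => ?_⟩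
  · have := hu (Pi.single j 1) (single_mem_stdSimplex ℝ j)
    have e : (fun i => if j = i then (1:ℝ) else 0) = Pi.single j 1 := by
      ext i; simp [Pi.single_apply, eq_comm]
    show 0 < - f (fun i => if j = i then (1:ℝ) else 0)
    rw [e]; linarith
  · have := LinearMap.pi_apply_eq_sum_univ (f : (J → ℝ) →ₗ[ℝ] ℝ) (L d)
    simp only [ContinuousLinearMap.coe_coe, hz, smul_eq_mul] at this
    simp only [neg_mul, Finset.sum_neg_distrib]
    refine neg_eq_zero.2 (Eq.trans ?_ this.symm)
    exact Finset.sum_congr rfl fun j _ => mul_comm _ _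

variable {n : ℕ} {m : Fin n → ℕ}

/-- Product distribution. -/
def prodM (x : ∀ i, Fin (m i) → ℝ) : Strat m → ℝ := fun p => ∏ j, x j (p j)

/-- Payoff of the pure strategy `s` of player `i` against the mixed profile `x`. -/
def pay (G : Game m) (i : Fin n) (s : Fin (m i)) (x : ∀ i, Fin (m i) → ℝ) : ℝ :=
  ∑ p : Strat m, if p i = s then G i p * ∏ j ∈ univ.erase i, x j (p j) else 0

lemma reindex (i : Fin n) (s t : Fin (m i)) (g : Strat m → ℝ) :
    (∑ p : Strat m, if p i = s then g (Function.update p i t) else 0)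
      = ∑ p : Strat m, if p i = t then g p else 0 := by
  rw [← Finset.sum_filter, ← Finset.sum_filter]
  refine Finset.sum_nbij' (fun p => Function.update p i t) (fun p => Function.update p i s)
    ?_ ?_ ?_ ?_ ?_
  · simp
  · simp
  · intro p hp
    simp only [mem_filter, mem_univ, true_and] at hp
    simp [← hp]
  · intro p hp
    simp only [mem_filter, mem_univ, true_and] at hp
    simp [← hp]
  · simp

lemma hIC_prodM (G : Game m) (i : Fin n) (s t : Fin (m i)) (x : ∀ i, Fin (m i) → ℝ) :
    hIC G i s t (prodM x) = x i s * (pay G i s x - pay G i t x) := by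
  have e : pay G i t x = ∑ p : Strat m, if p i = s then
      G i (Function.update p i t) * ∏ j ∈ univ.erase i, x j (p j) else 0 := by
    unfold pay
    rw [← reindex i s t (fun p => G i p * ∏ j ∈ univ.erase i, x j (p j))]
    refine Finset.sum_congr rfl fun p _ => ?_
    congr 2
    refine Finset.prod_congr rfl fun j hj => ?_
    rw [Function.update_of_ne (Finset.ne_of_mem_erase hj)]
  rw [e]
  unfold pay hIC
  rw [← Finset.sum_sub_distrib, Finset.mul_sum]
  refine Finset.sum_congr rfl fun p _ => ?_
  split_ifs with h
  · unfold prodM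
    rw [← Finset.mul_prod_erase univ _ (mem_univ i), h]
    ring
  · simp

lemma sum_prodM (x : ∀ i, Fin (m i) → ℝ) : ∑ p, prodM x p = ∏ i, ∑ s, x i s :=
  (Fintype.prod_sum x).symm

lemma marginal (x : ∀ i, Fin (m i) → ℝ) (i : Fin n) (s : Fin (m i))
    (hx : ∀ j, ∑ u, x j u = 1) :
    (∑ p : Strat m, if p i = s then prodM x p else 0) = x i s := by
  have h := sum_prodM (Function.update x i (fun u => if u = s then x i u else 0))
  rw [← Finset.mul_prod_erase univ _ (mem_univ i)] at h
  rw [Finset.prod_eq_one (s := univ.erase i)] at h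
  · simp only [Function.update_self, Finset.sum_ite_eq', mem_univ, if_true, mul_one] at h
    rw [← h]
    refine Finset.sum_congr rfl fun p _ => ?_
    unfold prodM
    rw [← Finset.mul_prod_erase univ _ (mem_univ i), ← Finset.mul_prod_erase univ _ (mem_univ i)]
    have e : ∏ j ∈ univ.erase i, (Function.update x i (fun u => if u = s then x i u else 0)) j (p j)
        = ∏ j ∈ univ.erase i, x j (p j) := Finset.prod_congr rfl fun j hj => by
      rw [Function.update_of_ne (Finset.ne_of_mem_erase hj)]
    rw [e]
    simp only [Function.update_self]
    split_ifs <;> simp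
  · intro j hj
    rw [Function.update_of_ne (Finset.ne_of_mem_erase hj)]
    exact hx j

/-- `hIC` as a linear map. -/
def hLin (G : Game m) (i : Fin n) (s t : Fin (m i)) : (Strat m → ℝ) →ₗ[ℝ] ℝ where
  toFun := hIC G i s t
  map_add' := by
    intro a b
    unfold hIC
    rw [← Finset.sum_add_distrib]
    refine Finset.sum_congr rfl fun p _ => ?_
    split_ifs <;> simp [add_mul]
  map_smul' := by
    intro c b
    unfold hIC
    rw [RingHom.id_apply, smul_eq_mul, Finset.mul_sum]
    refine Finset.sum_congr rfl fun p _ => ?_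
    split_ifs <;> simp [mul_assoc]

lemma hIC_add (G : Game m) (i : Fin n) (s t : Fin (m i)) (a b : Strat m → ℝ) :
    hIC G i s t (a + b) = hIC G i s t a + hIC G i s t b := (hLin G i s t).map_add a b
lemma hIC_sub (G : Game m) (i : Fin n) (s t : Fin (m i)) (a b : Strat m → ℝ) :
    hIC G i s t (a - b) = hIC G i s t a - hIC G i s t b := (hLin G i s t).map_sub a b
lemma hIC_smul (G : Game m) (i : Fin n) (s t : Fin (m i)) (c : ℝ) (b : Strat m → ℝ) :
    hIC G i s t (c • b) = c * hIC G i s t b := (hLin G i s t).map_smul c b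

lemma small (a b : ℝ) (ha : 0 ≤ a) (hb : a = 0 → 0 ≤ b) : ∀ᶠ e in 𝓝[>] (0:ℝ), 0 ≤ a + e * b := by
  rcases ha.eq_or_lt with h | h
  · filter_upwards [self_mem_nhdsWithin] with e he
    have : (0:ℝ) < e := he
    have := mul_nonneg this.le (hb h.symm)
    linarith
  · have : Tendsto (fun e : ℝ => a + e * b) (𝓝 0) (𝓝 (a + 0 * b)) :=
      Continuous.tendsto (by fun_prop) 0
    have := this.eventually (lt_mem_nhds (show (0:ℝ) < a + 0 * b by simpa using h))
    filter_upwards [nhdsWithin_le_nhds this] with e he using he.le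

/-- Key perturbation lemma. -/
lemma perturb (G : Game m) (σ : Strat m → ℝ) (hσ : IsCorrEq G σ)
    (hu : ∀ μ, IsCorrEq G μ → μ = σ) (d : Strat m → ℝ)
    (hd : ∀ p, σ p = 0 → 0 ≤ d p)
    (hh : ∀ i s t, hIC G i s t σ = 0 → 0 ≤ hIC G i s t d) : ∃ c : ℝ, d = c • σ := by
  have h1 : ∀ᶠ e in 𝓝[>] (0:ℝ), ∀ p, 0 ≤ σ p + e * d p :=
    eventually_all.2 fun p => small _ _ (hσ.1.1 p) (hd p)
  have h2 : ∀ᶠ e in 𝓝[>] (0:ℝ), ∀ i s t, 0 ≤ hIC G i s t σ + e * hIC G i s t d :=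
    eventually_all.2 fun i => eventually_all.2 fun s => eventually_all.2 fun t =>
      small _ _ (hσ.2 i s t) (hh i s t)
  have h3 : ∀ᶠ e in 𝓝[>] (0:ℝ), 0 < 1 + e * ∑ p, d p := by
    have : Tendsto (fun e : ℝ => 1 + e * ∑ p, d p) (𝓝 0) (𝓝 (1 + 0 * ∑ p, d p)) :=
      Continuous.tendsto (by fun_prop) 0
    exact nhdsWithin_le_nhds (this.eventually (lt_mem_nhds (by norm_num)))
  obtain ⟨e, ⟨⟨h1, h2⟩, h3⟩, he⟩ := (((h1.and h2).and h3).and self_mem_nhdsWithin).exists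
  have he : 0 < e := he
  set N := 1 + e * ∑ p, d p
  have hN : N⁻¹ • (σ + e • d) = σ := by
    apply hu
    refine ⟨⟨fun p => ?_, ?_⟩, fun i s t => ?_⟩
    · have := h1 p
      simp only [Pi.smul_apply, Pi.add_apply, smul_eq_mul]
      positivity
    · simp only [Pi.smul_apply, Pi.add_apply, smul_eq_mul, ← Finset.mul_sum,
        Finset.sum_add_distrib, hσ.1.2]
      exact inv_mul_cancel₀ h3.ne'
    · rw [hIC_smul, hIC_add, hIC_smul]
      have := h2 i s t
      positivity
  refine ⟨(N - 1) / e, ?_⟩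
  funext p
  have := congrFun hN p
  simp only [Pi.smul_apply, Pi.add_apply, smul_eq_mul] at this ⊢
  field_simp at this ⊢
  linarith

lemma pay_update (G : Game m) (i : Fin n) (s : Fin (m i)) (x : ∀ i, Fin (m i) → ℝ)
    (y : Fin (m i) → ℝ) : pay G i s (Function.update x i y) = pay G i s x := by
  unfold pay
  refine Finset.sum_congr rfl fun p _ => ?_
  congr 2
  refine Finset.prod_congr rfl fun j hj => ?_
  rw [Function.update_of_ne (Finset.ne_of_mem_erase hj)]

open Classical in
/-- Strictly positive dual certificate. -/
lemma exists_dual (G : Game m) (σ : Strat m → ℝ) (hσ : IsCorrEq G σ)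
    (hu : ∀ μ, IsCorrEq G μ → μ = σ) :
    ∃ (α : ∀ i, Fin (m i) → Fin (m i) → ℝ) (β : Strat m → ℝ),
      (∀ i s t, 0 ≤ α i s t) ∧ (∀ i s t, hIC G i s t σ = 0 → 0 < α i s t) ∧ (∀ p, 0 ≤ β p) ∧
      ∀ d, ∑ i, ∑ s, ∑ t, α i s t * hIC G i s t d + ∑ p, β p * d p = 0 := by
  let L : (Strat m → ℝ) →ₗ[ℝ] (Strat m ⊕ (Σ i, Fin (m i) × Fin (m i)) → ℝ) :=
    LinearMap.pi fun j => match j with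
      | Sum.inl p => if σ p = 0 then LinearMap.proj p else 0
      | Sum.inr q => if hIC G q.1 q.2.1 q.2.2 σ = 0 then hLin G q.1 q.2.1 q.2.2 else 0
  have L1 : ∀ d p, L d (Sum.inl p) = if σ p = 0 then d p else 0 := by
    intro d p
    simp only [L, LinearMap.pi_apply]
    split_ifs <;> simp
  have L2 : ∀ d i s t, L d (Sum.inr ⟨i, s, t⟩) =
      if hIC G i s t σ = 0 then hIC G i s t d else 0 := by
    intro d i s t
    simp only [L, LinearMap.pi_apply]
    split_ifs <;> simp [hLin]
  obtain ⟨a, ha, haL⟩ := stiemke L (by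
    intro d hd
    obtain ⟨c, rfl⟩ := perturb G σ hσ hu d
      (fun p hp => by have := hd (Sum.inl p); rwa [L1, if_pos hp] at this)
      (fun i s t hp => by have := hd (Sum.inr ⟨i, s, t⟩); rwa [L2, if_pos hp] at this)
    funext j
    rcases j with p | ⟨i, s, t⟩
    · rw [L1]; split_ifs with h <;> simp [h]
    · rw [L2]; split_ifs with h <;> simp [hIC_smul, h])
  refine ⟨fun i s t => if hIC G i s t σ = 0 then a (Sum.inr ⟨i, s, t⟩) else 0,
    fun p => if σ p = 0 then a (Sum.inl p) else 0, ?_, ?_, ?_, ?_⟩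
  · intro i s t
    dsimp only
    split_ifs
    · exact (ha _).le
    · exact le_rfl
  · intro i s t h
    dsimp only
    rw [if_pos h]; exact ha _
  · intro p
    dsimp only
    split_ifs
    · exact (ha _).le
    · exact le_rfl
  · intro d
    refine Eq.trans ?_ (haL d)
    rw [Fintype.sum_sum_type, add_comm]
    congr 1
    · refine Finset.sum_congr rfl fun p _ => ?_
      rw [L1]; split_ifs with h <;> simp [h]
    · rw [Fintype.sum_sigma]
      refine Finset.sum_congr rfl fun i _ => ?_
      rw [Fintype.sum_prod_type]
      refine Finset.sum_congr rfl fun s _ => Finset.sum_congr rfl fun t _ => ?_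
      rw [L2]; split_ifs with h <;> simp [h]

/-- A unique correlated equilibrium is a quasi-strict product. -/
lemma structure_lemma (hm : ∀ i, 0 < m i) (G : Game m) (σ : Strat m → ℝ) (hσ : IsCorrEq G σ)
    (hu : ∀ μ, IsCorrEq G μ → μ = σ) :
    ∃ x : ∀ i, Fin (m i) → ℝ, (∀ i s, 0 ≤ x i s) ∧ (∀ i, ∑ s, x i s = 1) ∧ σ = prodM x ∧
      ∀ i s t, 0 < x i s → hIC G i s t σ = 0 → 0 < x i t := by
  obtain ⟨α, β, hα, hα', hβ, hd⟩ := exists_dual G σ hσ hu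
  choose x hx0 hx1 hxs using fun i => exists_stationary (hm i) (α i) (hα i)
  have hP0 : ∀ p, 0 ≤ prodM x p := fun p => Finset.prod_nonneg fun j _ => hx0 j _
  have key : ∀ (y : ∀ i, Fin (m i) → ℝ) (j : Fin n), y j = x j →
      ∑ s, ∑ t, α j s t * hIC G j s t (prodM y) = 0 := by
    intro y j hy
    have h := hxs j (fun s => pay G j s y)
    rw [← neg_eq_zero, ← h, ← Finset.sum_neg_distrib]
    refine Finset.sum_congr rfl fun s _ => ?_
    rw [Finset.mul_sum, ← Finset.sum_neg_distrib]
    refine Finset.sum_congr rfl fun t _ => ?_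
    rw [hIC_prodM, hy]
    ring
  -- subharmonicity
  have hsub : ∀ i s, 0 ≤ ∑ t, α i s t * (pay G i t x - pay G i s x) := by
    intro i s
    have h := hd (prodM (Function.update x i (Pi.single s 1)))
    rw [Finset.sum_eq_single i
      (fun j _ hj => key _ j (Function.update_of_ne hj _ _)) (by simp)] at h
    simp only [hIC_prodM, pay_update, Function.update_self] at h
    rw [Finset.sum_eq_single s (by intro b _ hb; simp [hb]) (by simp)] at h
    have hb : 0 ≤ ∑ p, β p * prodM (Function.update x i (Pi.single s 1)) p := by
      refine Finset.sum_nonneg fun p _ => mul_nonneg (hβ p) (Finset.prod_nonneg fun j _ => ?_)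
      by_cases hj : j = i
      · subst hj
        rw [Function.update_self, Pi.single_apply]
        split_ifs <;> norm_num
      · rw [Function.update_of_ne hj]; exact hx0 j _
    have e : ∑ t, α i s t * (pay G i t x - pay G i s x) =
        - ∑ t, α i s t * ((Pi.single s (1:ℝ) : Fin (m i) → ℝ) s * (pay G i s x - pay G i t x)) := by
      rw [← Finset.sum_neg_distrib]
      refine Finset.sum_congr rfl fun t _ => ?_
      rw [Pi.single_eq_same]; ring
    rw [e]
    linarith
  have hharm : ∀ i s, x i s * ∑ t, α i s t * (pay G i t x - pay G i s x) = 0 := by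
    intro i s
    have h := hxs i (fun s => pay G i s x)
    rw [Finset.sum_eq_zero_iff_of_nonneg
      (fun s _ => mul_nonneg (hx0 i s) (hsub i s))] at h
    exact h s (mem_univ s)
  have hconst : ∀ i s t, 0 < x i s → 0 < α i s t → pay G i t x = pay G i s x := by
    intro i s t hs hst
    have h := hxs i (fun s => pay G i s x ^ 2)
    have e : ∑ s, x i s * ∑ t, α i s t * (pay G i t x - pay G i s x) ^ 2 = 0 := by
      calc ∑ s, x i s * ∑ t, α i s t * (pay G i t x - pay G i s x) ^ 2
          = ∑ s, (x i s * ∑ t, α i s t * (pay G i t x ^ 2 - pay G i s x ^ 2)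
            - 2 * pay G i s x * (x i s * ∑ t, α i s t * (pay G i t x - pay G i s x))) := by
            refine Finset.sum_congr rfl fun s _ => ?_
            simp only [Finset.mul_sum]
            rw [← Finset.sum_sub_distrib]
            refine Finset.sum_congr rfl fun t _ => ?_
            ring
        _ = 0 := by simp only [hharm, mul_zero, sub_zero]; exact h
    rw [Finset.sum_eq_zero_iff_of_nonneg (fun s _ => mul_nonneg (hx0 i s)
      (Finset.sum_nonneg fun t _ => mul_nonneg (hα i s t) (sq_nonneg _)))] at e
    have e1 := (mul_eq_zero.1 (e s (mem_univ s))).resolve_left hs.ne'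
    rw [Finset.sum_eq_zero_iff_of_nonneg
      (fun t _ => mul_nonneg (hα i s t) (sq_nonneg _))] at e1
    have e2 := (mul_eq_zero.1 (e1 t (mem_univ t))).resolve_left hst.ne'
    have := pow_eq_zero_iff (two_ne_zero) |>.1 e2
    linarith
  have hclosed : ∀ i s t, 0 < x i s → 0 < α i s t → 0 < x i t := by
    intro i s t hs hst
    by_contra hne
    have hxt : x i t = 0 := le_antisymm (not_lt.1 hne) (hx0 i t)
    have h := hxs i (Pi.single t 1)
    have e : ∀ s, x i s * ∑ u, α i s u * ((Pi.single t (1:ℝ) : Fin (m i) → ℝ) u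
        - (Pi.single t (1:ℝ) : Fin (m i) → ℝ) s) = x i s * α i s t := by
      intro s
      by_cases hst : s = t
      · subst hst; rw [hxt]; simp
      · rw [Pi.single_eq_of_ne hst]
        simp [Pi.single_apply]
    simp only [e] at h
    rw [Finset.sum_eq_zero_iff_of_nonneg (fun s _ => mul_nonneg (hx0 i s) (hα i s t))] at h
    have := h s (mem_univ s)
    have := mul_pos hs hst
    linarith
  have hsum : ∑ p, prodM x p = 1 := by
    rw [sum_prodM]; exact Finset.prod_eq_one fun i _ => hx1 i
  obtain ⟨c, hc⟩ := perturb G σ hσ hu (prodM x) (fun p _ => hP0 p) (by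
    intro i s t h
    rw [hIC_prodM]
    rcases (hx0 i s).eq_or_lt with h0 | h0
    · rw [← h0]; simp
    · rw [hconst i s t h0 (hα' i s t h)]; simp)
  have hc1 : c = 1 := by
    rw [hc] at hsum
    simpa [← Finset.mul_sum, hσ.1.2] using hsum
  rw [hc1, one_smul] at hc
  exact ⟨x, hx0, hx1, hc.symm, fun i s t hs h => hclosed i s t hs (hα' i s t h)⟩

/-- The square system defining equilibria with the support of `x0`. -/
noncomputable def esys (x0 : ∀ i, Fin (m i) → ℝ) (z : Game m × (∀ i, Fin (m i) → ℝ)) :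
    ∀ i, Fin (m i) → ℝ := fun i s =>
  if 0 < x0 i s then
    pay z.1 i s z.2 - ∑ t, x0 i t * pay z.1 i t z.2 + (∑ t, z.2 i t - 1)
  else z.2 i s

lemma contDiff_coord (i : Fin n) (s : Fin (m i)) :
    ContDiff ℝ 1 (fun z : Game m × (∀ i, Fin (m i) → ℝ) => z.2 i s) :=
  contDiff_pi.1 (contDiff_pi.1 (contDiff_snd (E := Game m) (F := ∀ i, Fin (m i) → ℝ)) i) s

lemma contDiff_pay (i : Fin n) (s : Fin (m i)) :
    ContDiff ℝ 1 (fun z : Game m × (∀ i, Fin (m i) → ℝ) => pay z.1 i s z.2) := by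
  unfold pay
  refine ContDiff.sum fun p _ => ?_
  split_ifs
  · refine ContDiff.mul (by fun_prop) ?_
    exact contDiff_prod fun j _ => contDiff_coord j (p j)
  · exact contDiff_const

lemma contDiff_esys (x0 : ∀ i, Fin (m i) → ℝ) : ContDiff ℝ 1 (esys (m := m) x0) := by
  refine contDiff_pi.2 fun i => contDiff_pi.2 fun s => ?_
  unfold esys
  have hp := fun t => contDiff_pay (m := m) i t
  split_ifs
  · exact ((hp s).sub (ContDiff.sum fun t _ => contDiff_const.mul (hp t))).add
      ((ContDiff.sum fun t _ => contDiff_coord i t).sub contDiff_const)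
  · exact contDiff_coord i s

lemma esys_spec (x0 : ∀ i, Fin (m i) → ℝ) (h0 : ∀ i s, 0 ≤ x0 i s) (h1 : ∀ i, ∑ s, x0 i s = 1)
    (G : Game m) (x : ∀ i, Fin (m i) → ℝ) (i : Fin n) :
    ∑ s, x0 i s * esys x0 (G, x) i s = ∑ t, x i t - 1 := by
  have : ∀ s, x0 i s * esys x0 (G, x) i s = x0 i s * pay G i s x
      - x0 i s * (∑ t, x0 i t * pay G i t x) + x0 i s * (∑ t, x i t - 1) := by
    intro s
    unfold esys
    split_ifs with h
    · ring
    · have : x0 i s = 0 := le_antisymm (not_lt.1 h) (h0 i s)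
      rw [this]; ring
  simp only [this, Finset.sum_add_distrib, Finset.sum_sub_distrib, ← Finset.sum_mul, h1]
  ring

lemma esys_inj (G : Game m) (σ : Strat m → ℝ) (hσ : IsCorrEq G σ)
    (hu : ∀ μ, IsCorrEq G μ → μ = σ) (x : ∀ i, Fin (m i) → ℝ)
    (h0 : ∀ i s, 0 ≤ x i s) (h1 : ∀ i, ∑ s, x i s = 1) (hx : σ = prodM x)
    (hcl : ∀ i s t, 0 < x i s → hIC G i s t σ = 0 → 0 < x i t)
    (δ : ∀ i, Fin (m i) → ℝ) (hδ : fderiv ℝ (esys x) (G, x) (0, δ) = 0) : δ = 0 := by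
  let c : ℝ → ∀ i, Fin (m i) → ℝ := fun e => x + e • δ
  have hcd : HasDerivAt (fun e : ℝ => ((G, c e) : Game m × (∀ i, Fin (m i) → ℝ))) (0, δ) 0 := by
    refine HasDerivAt.prodMk (hasDerivAt_const _ _) ?_
    have := ((hasDerivAt_id (0:ℝ)).smul_const δ).const_add x
    rw [one_smul] at this
    exact this
  have hc0 : c 0 = x := by simp [c]
  have hE : HasDerivAt (fun e : ℝ => esys x (G, c e)) 0 0 := by
    have hf : HasFDerivAt (esys x) (fderiv ℝ (esys x) (G, x)) (G, c 0) := by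
      rw [hc0]
      exact ((contDiff_esys x).differentiable (by norm_num) _).hasFDerivAt
    have := hf.comp_hasDerivAt (0:ℝ) hcd
    rwa [hδ] at this
  have hEi : ∀ i s, HasDerivAt (fun e : ℝ => esys x (G, c e) i s) 0 0 := by
    intro i s
    exact hasDerivAt_pi.1 (hasDerivAt_pi.1 hE i) s
  have hci : ∀ i s, HasDerivAt (fun e : ℝ => c e i s) (δ i s) 0 := by
    intro i s
    have := ((hasDerivAt_id (0:ℝ)).mul_const (δ i s)).const_add (x i s)
    simpa [c] using this
  have hsum : ∀ i, ∑ s, δ i s = 0 := by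
    intro i
    have a1 : HasDerivAt (fun e : ℝ => ∑ s, x i s * esys x (G, c e) i s)
        (∑ s, x i s * 0) 0 := HasDerivAt.fun_sum fun s _ => (hEi i s).const_mul (x i s)
    have a2 : HasDerivAt (fun e : ℝ => ∑ s, c e i s - 1) (∑ s, δ i s) 0 :=
      (HasDerivAt.fun_sum fun s _ => hci i s).sub_const 1
    have e : (fun e : ℝ => ∑ s, x i s * esys x (G, c e) i s) = fun e : ℝ => ∑ s, c e i s - 1 := by
      funext e
      exact esys_spec x h0 h1 G (c e) i
    rw [e] at a1
    rw [a2.unique a1]; simp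
  have hoff : ∀ i s, x i s = 0 → δ i s = 0 := by
    intro i s h
    have a := hEi i s
    have e : (fun e : ℝ => esys x (G, c e) i s) = fun e : ℝ => c e i s := by
      funext e
      unfold esys
      rw [if_neg (by rw [h]; exact lt_irrefl _)]
    rw [e] at a
    exact (hci i s).unique a
  have hcsum : ∀ e i, ∑ s, c e i s = 1 := by
    intro e i
    simp [c, Finset.sum_add_distrib, ← Finset.mul_sum, hsum, h1]
  let d : Strat m → ℝ := fun p => deriv (fun e => prodM (c e) p) 0
  have hd : ∀ p, HasDerivAt (fun e => prodM (c e) p) (d p) 0 := by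
    intro p
    refine DifferentiableAt.hasDerivAt ?_
    unfold prodM
    refine DifferentiableAt.fun_finsetProd fun j _ => ?_
    exact (hci j (p j)).differentiableAt
  have hh : ∀ i s t, HasDerivAt (fun e => hIC G i s t (prodM (c e))) (hIC G i s t d) 0 := by
    intro i s t
    unfold hIC
    refine HasDerivAt.fun_sum fun p _ => ?_
    split_ifs
    · exact (hd p).mul_const _
    · exact hasDerivAt_const _ _
  have hdoff : ∀ p, σ p = 0 → d p = 0 := by
    intro p hp
    rw [hx] at hp
    obtain ⟨j, -, hj⟩ := Finset.prod_eq_zero_iff.1 hp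
    have e : (fun e => prodM (c e) p) = fun _ => 0 := by
      funext e
      refine Finset.prod_eq_zero (mem_univ j) ?_
      simp [c, hj, hoff j _ hj]
    simp only [d, e, deriv_const]
  obtain ⟨k, hk⟩ := perturb G σ hσ hu d (fun p hp => (hdoff p hp).ge) (by
    intro i s t hst
    have a := hh i s t
    rcases (h0 i s).eq_or_lt with hs | hs
    · have e : (fun e => hIC G i s t (prodM (c e))) = fun _ => 0 := by
        funext e
        rw [hIC_prodM]
        simp [c, ← hs, hoff i s hs.symm]
      rw [e] at a
      exact (a.unique (hasDerivAt_const _ _)).ge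
    · have ht := hcl i s t hs hst
      have e : (fun e => hIC G i s t (prodM (c e))) =
          fun e => c e i s * (esys x (G, c e) i s - esys x (G, c e) i t) := by
        funext e
        rw [hIC_prodM]
        unfold esys
        rw [if_pos hs, if_pos ht]
        ring
      rw [e] at a
      have b := (hci i s).mul ((hEi i s).sub (hEi i t))
      have := a.unique b
      rw [this]
      have z : esys x (G, c 0) i s - esys x (G, c 0) i t = pay G i s x - pay G i t x := by
        rw [hc0]
        unfold esys
        rw [if_pos hs, if_pos ht]
        ring
      have z2 : pay G i s x - pay G i t x = 0 := by
        rw [hx, hIC_prodM] at hst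
        exact (mul_eq_zero.1 hst).resolve_left hs.ne'
      simp [z, z2])
  have hmar : ∀ i s, δ i s = k * x i s := by
    intro i s
    have a : HasDerivAt (fun e => ∑ p : Strat m, if p i = s then prodM (c e) p else 0)
        (∑ p : Strat m, if p i = s then d p else 0) 0 := by
      refine HasDerivAt.fun_sum fun p _ => ?_
      split_ifs
      · exact hd p
      · exact hasDerivAt_const _ _
    have e : (fun e => ∑ p : Strat m, if p i = s then prodM (c e) p else 0) =
        fun e => c e i s := by
      funext e
      exact marginal (c e) i s (hcsum e)
    rw [e] at a
    rw [(hci i s).unique a, hk, hx, ← marginal x i s h1, Finset.mul_sum]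
    refine Finset.sum_congr rfl fun p _ => ?_
    split_ifs <;> simp
  funext i s
  have hk0 : k = 0 := by
    have := hsum i
    simp only [hmar, ← Finset.mul_sum, h1, mul_one] at this
    exact this
  rw [hmar, hk0]; simp

lemma exists_near (G : Game m) (σ : Strat m → ℝ) (hσ : IsCorrEq G σ)
    (hu : ∀ μ, IsCorrEq G μ → μ = σ) (x : ∀ i, Fin (m i) → ℝ)
    (h0 : ∀ i s, 0 ≤ x i s) (h1 : ∀ i, ∑ s, x i s = 1) (hx : σ = prodM x)
    (hcl : ∀ i s t, 0 < x i s → hIC G i s t σ = 0 → 0 < x i t)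
    (hz : esys x (G, x) = 0)
    (P : Game m × (∀ i, Fin (m i) → ℝ) → Prop) (hP : ∀ᶠ z in 𝓝 (G, x), P z) :
    ∀ᶠ G' in 𝓝 G, ∃ x', esys x (G', x') = 0 ∧ P (G', x') := by
  let Φ : Game m × (∀ i, Fin (m i) → ℝ) → Game m × (∀ i, Fin (m i) → ℝ) :=
    fun z => (z.1, esys x z)
  have hs : HasStrictFDerivAt (esys x) (fderiv ℝ (esys x) (G, x)) (G, x) :=
    (contDiff_esys x).contDiffAt.hasStrictFDerivAt one_ne_zero
  have hΦ : HasStrictFDerivAt Φ ((ContinuousLinearMap.fst ℝ (Game m) (∀ i, Fin (m i) → ℝ)).prod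
      (fderiv ℝ (esys x) (G, x))) (G, x) := hasStrictFDerivAt_fst.prodMk hs
  have hinj : Function.Injective ((ContinuousLinearMap.fst ℝ (Game m) (∀ i, Fin (m i) → ℝ)).prod
      (fderiv ℝ (esys x) (G, x))).toLinearMap := by
    rw [injective_iff_map_eq_zero]
    rintro ⟨H, δ⟩ h
    have ha : H = 0 := congrArg Prod.fst h
    subst ha
    have hb : fderiv ℝ (esys x) (G, x) (0, δ) = 0 := congrArg Prod.snd h
    rw [esys_inj G σ hσ hu x h0 h1 hx hcl δ hb]
    rfl
  have hmap := hΦ.map_nhds_eq_of_surj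
    (LinearMap.range_eq_top.2 (LinearMap.injective_iff_surjective.1 hinj))
  have h3 : ∀ᶠ w in 𝓝 (Φ (G, x)), ∃ z, Φ z = w ∧ P z := by
    rw [← hmap, Filter.eventually_map]
    filter_upwards [hP] with z h using ⟨z, rfl, h⟩
  have e : Φ (G, x) = (G, 0) := by simp [Φ, hz]
  rw [e] at h3
  have h4 : Tendsto (fun G' : Game m => (G', (0 : ∀ i, Fin (m i) → ℝ))) (𝓝 G) (𝓝 (G, 0)) :=
    Continuous.tendsto (by fun_prop) G
  filter_upwards [h4.eventually h3] with G' hG'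
  obtain ⟨⟨G'', x'⟩, hw, hp⟩ := hG'
  have ha : G'' = G' := congrArg Prod.fst hw
  subst ha
  exact ⟨x', congrArg Prod.snd hw, hp⟩

lemma continuous_hIC (i : Fin n) (s t : Fin (m i)) :
    Continuous (fun z : Game m × (Strat m → ℝ) => hIC z.1 i s t z.2) := by
  unfold hIC
  refine continuous_finsetSum _ fun p _ => ?_
  split_ifs
  · fun_prop
  · exact continuous_const

lemma unique_near (G : Game m) (σ : Strat m → ℝ) (hσ : IsCorrEq G σ)
    (hu : ∀ μ, IsCorrEq G μ → μ = σ) :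
    ∀ᶠ G' in 𝓝 G, ∀ d : Strat m → ℝ, ∑ p, d p = 0 → (∀ p, σ p = 0 → 0 ≤ d p) →
      (∀ i s t, hIC G i s t σ = 0 → 0 ≤ hIC G' i s t d) → d = 0 := by
  let K : Set (Strat m → ℝ) := Metric.sphere 0 1 ∩ {d | ∑ p, d p = 0 ∧ ∀ p, σ p = 0 → 0 ≤ d p}
  have hK : IsCompact K := by
    refine (isCompact_sphere 0 1).inter_right ?_
    have e : {d : Strat m → ℝ | ∑ p, d p = 0 ∧ ∀ p, σ p = 0 → 0 ≤ d p} =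
        {d | ∑ p, d p = 0} ∩ ⋂ p, ⋂ (_ : σ p = 0), {d | 0 ≤ d p} := by
      ext d; simp
    rw [e]
    refine IsClosed.inter (isClosed_eq (by fun_prop) continuous_const) ?_
    exact isClosed_iInter fun p => isClosed_iInter fun _ =>
      isClosed_le continuous_const (continuous_apply p)
  have := hK.eventually_forall_of_forall_eventually (x₀ := G)
    (P := fun G' d => ∃ i s t, hIC G i s t σ = 0 ∧ hIC G' i s t d < 0) (by
      intro d hd
      have hne : ∃ i s t, hIC G i s t σ = 0 ∧ hIC G i s t d < 0 := by
        by_contra! hcon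
        obtain ⟨c, rfl⟩ := perturb G σ hσ hu d hd.2.2 hcon
        have h1 := hd.2.1
        simp only [Pi.smul_apply, smul_eq_mul, ← Finset.mul_sum, hσ.1.2, mul_one] at h1
        have h2 := hd.1
        simp [h1] at h2
      obtain ⟨i, s, t, h1, h2⟩ := hne
      have := (continuous_hIC i s t).tendsto (G, d)
      filter_upwards [this.eventually (gt_mem_nhds h2)] with z hz using ⟨i, s, t, h1, hz⟩)
  filter_upwards [this] with G' hG' d hs hd hh
  by_contra hne
  have hn : 0 < ‖d‖ := norm_pos_iff.2 hne
  obtain ⟨i, s, t, h1, h2⟩ := hG' (‖d‖⁻¹ • d) ⟨by simp [norm_smul, hn.ne'], by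
      simp [← Finset.mul_sum, hs], fun p hp => by
      have := hd p hp
      simp only [Pi.smul_apply, smul_eq_mul]
      positivity⟩
  rw [hIC_smul] at h2
  have := hh i s t h1
  have : 0 ≤ ‖d‖⁻¹ * hIC G' i s t d := by positivity
  linarith

end UCE
end UCEsec

/-- the set of `n`-player games of size `m 0 × ⋯ × m (n-1)` having a unique
correlated equilibrium is open. -/
theorem statement0 (n : ℕ) (m : Fin n → ℕ) (hm : ∀ i, 0 < m i) :
    IsOpen {G : Game m | ∃! μ : Strat m → ℝ, IsCorrEq G μ} := by
  rw [isOpen_iff_mem_nhds]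
  rintro G ⟨σ, hσ, hu⟩
  obtain ⟨x, h0, h1, hx, hcl⟩ := UCE.structure_lemma hm G σ hσ hu
  have hpe : ∀ i s t, 0 < x i s → 0 ≤ UCE.pay G i s x - UCE.pay G i t x := by
    intro i s t hs
    have := hσ.2 i s t
    rw [hx, UCE.hIC_prodM] at this
    exact nonneg_of_mul_nonneg_right this hs
  have hpeq : ∀ i s t, 0 < x i s → 0 < x i t → UCE.pay G i s x = UCE.pay G i t x := by
    intro i s t hs ht
    linarith [hpe i s t hs, hpe i t s ht]
  have hplt : ∀ i s t, 0 < x i s → ¬ 0 < x i t → UCE.pay G i t x < UCE.pay G i s x := by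
    intro i s t hs ht
    refine lt_of_le_of_ne (by linarith [hpe i s t hs]) fun h => ht (hcl i s t hs ?_)
    rw [hx, UCE.hIC_prodM, h, sub_self, mul_zero]
  have hz : UCE.esys x (G, x) = 0 := by
    funext i s
    unfold UCE.esys
    split_ifs with hs
    · have : ∑ t, x i t * UCE.pay G i t x = ∑ t, x i t * UCE.pay G i s x := by
        refine Finset.sum_congr rfl fun t _ => ?_
        rcases (h0 i t).eq_or_lt with ht | ht
        · rw [← ht]; simp
        · rw [hpeq i s t hs ht]
      simp only [this, ← Finset.sum_mul, h1]
      simp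
    · exact le_antisymm (not_lt.1 hs) (h0 i s)
  have hcp := fun (i : Fin n) (s : Fin (m i)) => (UCE.contDiff_pay (m := m) i s).continuous
  have hP1 : ∀ᶠ z : Game m × (∀ i, Fin (m i) → ℝ) in nhds (G, x), ∀ i s, 0 < x i s → 0 < z.2 i s := by
    refine Filter.eventually_all.2 fun i => Filter.eventually_all.2 fun s => ?_
    by_cases hs : 0 < x i s
    · have hc : Continuous (fun z : Game m × (∀ i, Fin (m i) → ℝ) => z.2 i s) := by fun_prop
      filter_upwards [(hc.tendsto (G, x)).eventually (lt_mem_nhds hs)] with z hz _ using hz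
    · exact Filter.Eventually.of_forall fun z h => absurd h hs
  have hP2 : ∀ᶠ z : Game m × (∀ i, Fin (m i) → ℝ) in nhds (G, x), ∀ i s t, 0 < x i s →
      ¬ 0 < x i t → UCE.pay z.1 i t z.2 < UCE.pay z.1 i s z.2 := by
    refine Filter.eventually_all.2 fun i => Filter.eventually_all.2 fun s =>
      Filter.eventually_all.2 fun t => ?_
    by_cases hs : 0 < x i s ∧ ¬ 0 < x i t
    · filter_upwards [((hcp i t).tendsto (G, x)).eventually_lt ((hcp i s).tendsto (G, x))
        (hplt i s t hs.1 hs.2)] with z hz _ _ using hz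
    · exact Filter.Eventually.of_forall fun z h h' => absurd ⟨h, h'⟩ hs
  filter_upwards [UCE.exists_near G σ hσ hu x h0 h1 hx hcl hz _ (hP1.and hP2),
    UCE.unique_near G σ hσ hu] with G' hE hU
  obtain ⟨y, hy, hy1, hy2⟩ := hE
  have hysum : ∀ i, ∑ s, y i s = 1 := by
    intro i
    have := UCE.esys_spec x h0 h1 G' y i
    rw [hy] at this
    simp at this
    linarith
  have hyoff : ∀ i s, ¬ 0 < x i s → y i s = 0 := by
    intro i s hs
    have := congrFun (congrFun hy i) s
    unfold UCE.esys at this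
    rw [if_neg hs] at this
    exact this
  have hy0 : ∀ i s, 0 ≤ y i s := by
    intro i s
    by_cases hs : 0 < x i s
    · exact (hy1 i s hs).le
    · exact (hyoff i s hs).ge
  have hyeq : ∀ i s t, 0 < x i s → 0 < x i t → UCE.pay G' i s y = UCE.pay G' i t y := by
    intro i s t hs ht
    have a := congrFun (congrFun hy i) s
    have b := congrFun (congrFun hy i) t
    unfold UCE.esys at a b
    rw [if_pos hs] at a
    rw [if_pos ht] at b
    simp only [Pi.zero_apply] at a b
    linarith
  have hyCE : IsCorrEq G' (UCE.prodM y) := by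
    refine ⟨⟨fun p => Finset.prod_nonneg fun j _ => hy0 j _, ?_⟩, fun i s t => ?_⟩
    · rw [UCE.sum_prodM]; exact Finset.prod_eq_one fun i _ => hysum i
    · rw [UCE.hIC_prodM]
      by_cases hs : 0 < x i s
      · refine mul_nonneg (hy0 i s) ?_
        by_cases ht : 0 < x i t
        · rw [hyeq i s t hs ht, sub_self]
        · exact (sub_pos.2 (hy2 i s t hs ht)).le
      · rw [hyoff i s hs, zero_mul]
  refine ⟨UCE.prodM y, hyCE, fun ν hν => ?_⟩
  refine sub_eq_zero.1 (hU (ν - UCE.prodM y) ?_ ?_ ?_)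
  · simp only [Pi.sub_apply, Finset.sum_sub_distrib, hν.1.2, hyCE.1.2, sub_self]
  · intro p hp
    rw [hx] at hp
    obtain ⟨j, -, hj⟩ := Finset.prod_eq_zero_iff.1 hp
    have : UCE.prodM y p = 0 :=
      Finset.prod_eq_zero (Finset.mem_univ j) (hyoff j _ (by rw [hj]; exact lt_irrefl _))
    rw [Pi.sub_apply, this, sub_zero]
    exact hν.1.1 p
  · intro i s t hst
    rw [UCE.hIC_sub]
    have : UCE.pay G' i s y = UCE.pay G' i t y ∨ y i s = 0 := by
      by_cases hs : 0 < x i s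
      · exact Or.inl (hyeq i s t hs (hcl i s t hs hst))
      · exact Or.inr (hyoff i s hs)
    have e : hIC G' i s t (UCE.prodM y) = 0 := by
      rw [UCE.hIC_prodM]
      rcases this with h | h
      · rw [h, sub_self, mul_zero]
      · rw [h, zero_mul]
    rw [e, sub_zero]
    exact hν.2 i s t
end

section
/- If a finite n-player game G has a unique correlated equilibrium σ, then there exists a neighborhood of G (in the space of games of the same size) such that every game in this neighborhood has a unique correlated equilibrium, and this correlated equilibrium has the same support as σ. -/
theorem farkas_aux {W J : Type*} [AddCommGroup W] [Module ℝ W] [DecidableEq J] (s : Finset J) :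
    ∀ (a : J → (W →ₗ[ℝ] ℝ)) (b : W →ₗ[ℝ] ℝ),
      (∀ x, (∀ j ∈ s, 0 ≤ a j x) → 0 ≤ b x) →
      ∃ l : J → ℝ, (∀ j, 0 ≤ l j) ∧ ∀ x, b x = ∑ j ∈ s, l j * a j x := by
  induction s using Finset.induction_on with
  | empty =>
    intro a b h
    refine ⟨fun _ => 0, fun _ => le_rfl, fun x => ?_⟩
    have h1 := h x (by simp)
    have h2 := h (-x) (by simp)
    rw [map_neg] at h2
    simp; linarith
  | insert q s hq ih =>
    intro a b h
    by_cases hc : ∀ x, (∀ j ∈ s, 0 ≤ a j x) → 0 ≤ b x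
    · obtain ⟨l, hl, hb⟩ := ih a b hc
      refine ⟨fun j => if j = q then 0 else l j, fun j => ?_, fun x => ?_⟩
      · dsimp only; split_ifs
        · exact le_rfl
        · exact hl j
      · rw [Finset.sum_insert hq, hb x]
        simp only [if_true, zero_mul, zero_add]
        refine Finset.sum_congr rfl fun j hj => ?_
        rw [if_neg (fun e : j = q => hq (e ▸ hj))]
    · push Not at hc
      obtain ⟨z, hz, hbz⟩ := hc
      have hqz : a q z < 0 := by
        by_contra hh
        push Not at hh
        have := h z (fun j hj => by
          rcases Finset.mem_insert.1 hj with rfl | hj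
          · exact hh
          · exact hz j hj)
        linarith
      -- normalise
      set r : ℝ := -(a q z)⁻¹ with hr
      have hrpos : 0 < r := by rw [hr]; exact neg_pos.2 (inv_lt_zero.2 hqz)
      have hrq : a q (r • z) = -1 := by
        rw [map_smul, smul_eq_mul, hr]; field_simp [hqz.ne]
      set y := r • z with hy
      have hyj : ∀ j ∈ s, 0 ≤ a j y := fun j hj => by
        rw [hy, map_smul, smul_eq_mul]; exact mul_nonneg hrpos.le (hz j hj)
      have hby : b y < 0 := by
        rw [hy, map_smul, smul_eq_mul]; exact mul_neg_of_pos_of_neg hrpos hbz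
      obtain ⟨l, hl, hb⟩ := ih (fun j => a j + (a j y) • a q) (b + (b y) • a q) (by
        intro x hx
        have := h (x + (a q x) • y) (fun j hj => by
          rcases Finset.mem_insert.1 hj with rfl | hj
          · rw [map_add, map_smul, smul_eq_mul, hrq]; linarith
          · have := hx j hj
            simp only [LinearMap.add_apply, LinearMap.smul_apply, smul_eq_mul] at this
            rw [map_add, map_smul, smul_eq_mul]; linarith)
        simp only [LinearMap.add_apply, LinearMap.smul_apply, smul_eq_mul]
        rw [map_add, map_smul, smul_eq_mul] at this
        linarith)
      refine ⟨fun j => if j = q then (∑ i ∈ s, l i * a i y) - b y else l j, fun j => ?_, fun x => ?_⟩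
      · dsimp only; split_ifs
        · have := Finset.sum_nonneg (fun i hi => mul_nonneg (hl i) (hyj i hi))
          linarith
        · exact hl j
      · rw [Finset.sum_insert hq]
        have h1 : ∑ j ∈ s, (if j = q then (∑ i ∈ s, l i * a i y) - b y else l j) * a j x
            = ∑ j ∈ s, l j * a j x := by
          refine Finset.sum_congr rfl fun j hj => ?_
          rw [if_neg (fun e : j = q => hq (e ▸ hj))]
        have h2 := hb x
        simp only [LinearMap.add_apply, LinearMap.smul_apply, smul_eq_mul, mul_add,
          Finset.sum_add_distrib] at h2
        rw [h1]
        simp only [if_true]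
        have h3 : ∑ i ∈ s, l i * (a i y * a q x) = (∑ i ∈ s, l i * a i y) * a q x := by
          rw [Finset.sum_mul]; exact Finset.sum_congr rfl fun i _ => by ring
        rw [h3] at h2
        linarith

theorem farkas_nn {J X : Type*} [Fintype J] [Fintype X] (A : J → X → ℝ) (b : X → ℝ)
    (h : ∀ x : X → ℝ, (∀ s, 0 ≤ x s) → (∀ j, 0 ≤ ∑ s, x s * A j s) → 0 ≤ ∑ s, x s * b s) :
    ∃ l : J → ℝ, (∀ j, 0 ≤ l j) ∧ ∀ s, ∑ j, l j * A j s ≤ b s := by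
  classical
  let f : (X → ℝ) → ((X → ℝ) →ₗ[ℝ] ℝ) := fun c =>
    { toFun := fun x => ∑ s, x s * c s
      map_add' := fun x y => by simp [add_mul, Finset.sum_add_distrib]
      map_smul' := fun r x => by simp [Finset.mul_sum, mul_assoc] }
  have hf : ∀ c x, f c x = ∑ s, x s * c s := fun _ _ => rfl
  obtain ⟨l, hl, hb⟩ := farkas_aux (Finset.univ : Finset (J ⊕ X))
    (fun j => Sum.elim (fun j => f (A j)) (fun t => f (Pi.single t 1)) j) (f b) (by
      intro x hx
      refine h x (fun s => ?_) (fun j => hx (Sum.inl j) (Finset.mem_univ _))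
      have := hx (Sum.inr s) (Finset.mem_univ _)
      simpa [hf, Pi.single_apply] using this)
  refine ⟨fun j => l (Sum.inl j), fun j => hl _, fun s => ?_⟩
  have := hb (Pi.single s 1)
  simp [hf, Pi.single_apply] at this
  have h2 := hl (Sum.inr s)
  linarith

theorem invariant_exists {X : Type*} [Fintype X] (a : X → X → ℝ) (ha : ∀ s t, 0 ≤ a s t)
    (C : X → Prop) (hC : ∃ x, C x) (hcl : ∀ s t, C s → 0 < a s t → C t) :
    ∃ p : X → ℝ, (∀ s, 0 ≤ p s) ∧ ∑ s, p s = 1 ∧ (∀ s, ¬ C s → p s = 0) ∧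
      ∀ t, ∑ s, p s * a s t = p t * ∑ u, a t u := by
  classical
  by_contra hno
  let B : X → X → ℝ := fun t s => a s t - if s = t then ∑ u, a t u else 0
  have hB : ∀ (x : X → ℝ) t, ∑ s, x s * B t s = ∑ s, x s * a s t - x t * ∑ u, a t u := by
    intro x t
    simp [B, mul_sub, Finset.sum_sub_distrib]
  obtain ⟨l, hl, hb⟩ := farkas_nn (J := X ⊕ X ⊕ X)
    (fun j s => Sum.elim (fun t => B t s) (Sum.elim (fun t => - B t s)
      (fun t => if s = t ∧ ¬ C t then -1 else 0)) j) (fun _ => -1) (by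
      intro x hx hA
      by_contra hneg
      have hpos : 0 < ∑ s, x s := by
        simp only [mul_neg, mul_one, Finset.sum_neg_distrib] at hneg
        linarith
      have hA1 : ∀ t, 0 ≤ ∑ s, x s * B t s := fun t => hA (Sum.inl t)
      have hA2 : ∀ t, 0 ≤ ∑ s, x s * (- B t s) := fun t => hA (Sum.inr (Sum.inl t))
      have hA3 : ∀ t, ¬ C t → x t = 0 := by
        intro t ht
        have := hA (Sum.inr (Sum.inr t))
        simp [ht] at this
        exact le_antisymm this (hx t)
      refine hno ⟨fun s => x s / ∑ s, x s, fun s => div_nonneg (hx s) hpos.le, ?_, ?_, ?_⟩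
      · rw [← Finset.sum_div, div_self hpos.ne']
      · intro s hs; simp [hA3 s hs]
      · intro t
        have h1 := hA1 t
        have h2 := hA2 t
        simp only [mul_neg, Finset.sum_neg_distrib] at h2
        rw [hB] at h1 h2
        have h3 : ∑ s, x s * a s t = x t * ∑ u, a t u := by linarith
        simp only [div_mul_eq_mul_div]
        rw [← Finset.sum_div, h3])
  let f : X → ℝ := fun t => l (Sum.inl t) - l (Sum.inr (Sum.inl t))
  obtain ⟨x0, hx0⟩ := hC
  obtain ⟨s, hs, hmin⟩ := Finset.exists_min_image (Finset.univ.filter C) f ⟨x0, by simp [hx0]⟩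
  have hsC : C s := by simpa using hs
  have h1 := hb s
  simp only [Fintype.sum_sum_type, Sum.elim_inl, Sum.elim_inr] at h1
  have h2 : ∑ x, l (Sum.inr (Sum.inr x)) * (if s = x ∧ ¬ C x then (-1 : ℝ) else 0) = 0 := by
    refine Finset.sum_eq_zero fun x _ => ?_
    rw [if_neg, mul_zero]
    rintro ⟨rfl, h⟩; exact h hsC
  rw [h2, add_zero, ← Finset.sum_add_distrib] at h1
  have h3 : ∑ t, (l (Sum.inl t) * B t s + l (Sum.inr (Sum.inl t)) * -B t s)
      = ∑ t, a s t * (f t - f s) := by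
    have : ∀ t, (l (Sum.inl t) * B t s + l (Sum.inr (Sum.inl t)) * -B t s) = f t * B t s := by
      intro t; simp only [f]; ring
    simp only [this]
    simp only [B, mul_sub, Finset.sum_sub_distrib, ← Finset.sum_mul, mul_ite, mul_zero,
      Finset.sum_ite_eq, Finset.mem_univ, if_true]
    rw [mul_comm (f s)]
    congr 1
    exact Finset.sum_congr rfl fun t _ => mul_comm _ _
  rw [h3] at h1
  have h4 : 0 ≤ ∑ t, a s t * (f t - f s) := by
    refine Finset.sum_nonneg fun t _ => ?_
    rcases (ha s t).eq_or_lt with h | h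
    · rw [← h, zero_mul]
    · exact mul_nonneg h.le (sub_nonneg.2 (hmin t (by simpa using hcl s t hsC h)))
  linarith

theorem perturb {Y J S : Type*} [TopologicalSpace Y] [Fintype J] [Fintype S] [DecidableEq S]
    (A : Y → Matrix J S ℝ) (hA : Continuous A) (y0 : Y)
    (hinj : ∀ x, (A y0).mulVec x = 0 → x = 0) :
    (∀ b : Y → S → ℝ, Continuous b → b y0 = 0 → ∃ v : Y → J → ℝ, ContinuousAt v y0 ∧ v y0 = 0 ∧
      ∀ᶠ y in nhds y0, Matrix.vecMul (v y) (A y) = b y) ∧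
    (∀ e : J → ℝ, ∃ F : Y → S → ℝ, ContinuousAt F y0 ∧
      ∀ᶠ y in nhds y0, ∀ x, (A y).mulVec x = e → x = F y) := by
  let N : Y → Matrix S S ℝ := fun y => (A y).transpose * A y
  have hN : Continuous N := (hA.matrix_transpose).matrix_mul hA
  have hdet : (N y0).det ≠ 0 := by
    intro h0
    obtain ⟨v, hv, hv2⟩ := Matrix.exists_mulVec_eq_zero_iff.2 h0
    refine hv (hinj v ?_)
    have : v ⬝ᵥ (N y0).mulVec v = 0 := by rw [hv2]; simp
    rw [← Matrix.mulVec_mulVec, Matrix.dotProduct_mulVec, Matrix.vecMul_transpose] at this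
    exact dotProduct_self_eq_zero.1 this
  have hev : ∀ᶠ y in nhds y0, (N y).det ≠ 0 :=
    hN.matrix_det.continuousAt.eventually_ne hdet
  have hNi : ContinuousAt (fun y => (N y)⁻¹) y0 := by
    simp only [Matrix.inv_def, Ring.inverse_eq_inv']
    exact (hN.matrix_det.continuousAt.inv₀ hdet).smul hN.matrix_adjugate.continuousAt
  constructor
  · intro b hb hb0
    refine ⟨fun y => (A y).mulVec ((N y)⁻¹.mulVec (b y)), ?_, ?_, ?_⟩
    · have h1 : Continuous (fun q : Matrix J S ℝ × Matrix S S ℝ × (S → ℝ) =>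
          q.1.mulVec (q.2.1.mulVec q.2.2)) :=
        (continuous_fst).matrix_mulVec
          ((continuous_fst.comp continuous_snd).matrix_mulVec (continuous_snd.comp continuous_snd))
      exact h1.continuousAt.comp (hA.continuousAt.prodMk (hNi.prodMk hb.continuousAt))
    · simp [hb0]
    · filter_upwards [hev] with y hy
      rw [← Matrix.mulVec_transpose, Matrix.mulVec_mulVec]
      change (N y).mulVec _ = _
      rw [Matrix.mulVec_mulVec, Matrix.mul_nonsing_inv _ (isUnit_iff_ne_zero.2 hy),
        Matrix.one_mulVec]
  · intro e
    refine ⟨fun y => (N y)⁻¹.mulVec ((A y).transpose.mulVec e), ?_, ?_⟩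
    · have h1 : Continuous (fun q : Matrix J S ℝ × Matrix S S ℝ =>
          q.2.mulVec (q.1.transpose.mulVec e)) :=
        continuous_snd.matrix_mulVec (continuous_fst.matrix_transpose.matrix_mulVec continuous_const)
      exact h1.continuousAt.comp (hA.continuousAt.prodMk hNi)
    · filter_upwards [hev] with y hy x hx
      have h2 : (A y).transpose.mulVec ((A y).mulVec x) = (N y).mulVec x := Matrix.mulVec_mulVec _ _ _
      rw [← hx, h2, Matrix.mulVec_mulVec, Matrix.nonsing_inv_mul _ (isUnit_iff_ne_zero.2 hy),
        Matrix.one_mulVec]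

/-- Index of incentive constraints. -/
abbrev Dev {n : ℕ} (m : Fin n → ℕ) : Type := Σ i : Fin n, Fin (m i) × Fin (m i)

/-- Coefficients of the incentive constraints. -/
def gc {n : ℕ} {m : Fin n → ℕ} (G : Game m) (k : Dev m) (s : Strat m) : ℝ :=
  if s k.1 = k.2.1 then G k.1 s - G k.1 (Function.update s k.1 k.2.2) else 0

theorem hIC_eq {n : ℕ} {m : Fin n → ℕ} (G : Game m) (i : Fin n) (si ti : Fin (m i))
    (μ : Strat m → ℝ) : hIC G i si ti μ = ∑ s, μ s * gc G ⟨i, si, ti⟩ s := by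
  unfold hIC gc
  refine Finset.sum_congr rfl fun s _ => ?_
  simp only [mul_ite, mul_zero]

theorem isCorrEq_iff {n : ℕ} {m : Fin n → ℕ} (G : Game m) (μ : Strat m → ℝ) :
    IsCorrEq G μ ↔ (∀ s, 0 ≤ μ s) ∧ ∑ s, μ s = 1 ∧ ∀ k, 0 ≤ ∑ s, μ s * gc G k s := by
  unfold IsCorrEq IsCorrStrat
  constructor
  · rintro ⟨⟨h1, h2⟩, h3⟩
    exact ⟨h1, h2, fun k => by have := h3 k.1 k.2.1 k.2.2; rwa [hIC_eq] at this⟩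
  · rintro ⟨h1, h2, h3⟩
    exact ⟨⟨h1, h2⟩, fun i si ti => by rw [hIC_eq]; exact h3 _⟩

theorem hs_lemma {n : ℕ} {m : Fin n → ℕ} (G : Game m) (α : Dev m → ℝ)
    (p : ∀ i, Fin (m i) → ℝ)
    (hp : ∀ i t, ∑ s, p i s * α ⟨i, s, t⟩ = p i t * ∑ u, α ⟨i, t, u⟩) :
    ∑ s : Strat m, (∏ i, p i (s i)) * ∑ k, α k * gc G k s = 0 := by
  have h0 : ∀ s : Strat m, ∑ k, α k * gc G k s
      = ∑ i, ∑ t, α ⟨i, s i, t⟩ * (G i s - G i (Function.update s i t)) := by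
    intro s
    rw [Fintype.sum_sigma]
    refine Finset.sum_congr rfl fun i _ => ?_
    rw [Fintype.sum_prod_type]
    rw [Finset.sum_eq_single (s i)]
    · simp [gc]
    · intro b _ hb
      refine Finset.sum_eq_zero fun t _ => ?_
      simp [gc, hb.symm]
    · simp
  simp only [h0, Finset.mul_sum]
  rw [Finset.sum_comm]
  refine Finset.sum_eq_zero fun i _ => ?_
  let w : Strat m → ℝ := fun s => ∏ j ∈ Finset.univ.erase i, p j (s j)
  have hw : ∀ s : Strat m, ∏ j, p j (s j) = p i (s i) * w s := fun s =>
    (Finset.mul_prod_erase _ (fun j => p j (s j)) (Finset.mem_univ i)).symm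
  have hwu : ∀ (s : Strat m) t, w (Function.update s i t) = w s := by
    intro s t
    refine Finset.prod_congr rfl fun j hj => ?_
    rw [Function.update_of_ne (Finset.ne_of_mem_erase hj)]
  let Φ : Strat m × Fin (m i) → Strat m × Fin (m i) := fun q => (Function.update q.1 i q.2, q.1 i)
  have hΦ : Function.Involutive Φ := by
    rintro ⟨s, t⟩
    simp [Φ]
  have h1 : ∑ s : Strat m, ∑ t, (∏ j, p j (s j)) * (α ⟨i, s i, t⟩ * G i (Function.update s i t))
      = ∑ s : Strat m, ∑ t, w s * G i s * (p i t * α ⟨i, t, s i⟩) := by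
    rw [← Fintype.sum_prod_type', ← Fintype.sum_prod_type']
    refine Fintype.sum_equiv hΦ.toPerm _ _ ?_
    rintro ⟨s, t⟩
    simp only [Function.Involutive.coe_toPerm, Φ, hwu, hw, Function.update_self]
    ring
  simp only [mul_sub, Finset.sum_sub_distrib]
  rw [h1]
  simp only [← Finset.mul_sum, hp, hw]
  rw [sub_eq_zero]
  refine Finset.sum_congr rfl fun s _ => ?_
  rw [← Finset.sum_mul]
  ring

theorem sum_prod_one {n : ℕ} {m : Fin n → ℕ} (p : ∀ i, Fin (m i) → ℝ)
    (hp : ∀ i, ∑ s, p i s = 1) : ∑ s : Strat m, ∏ i, p i (s i) = 1 := by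
  rw [← Fintype.prod_sum]
  simp [hp]

/-- For a nonnegative deviation plan, product invariant distribution on closed sets. -/
theorem inv_family {n : ℕ} {m : Fin n → ℕ} (α : Dev m → ℝ) (hα : ∀ k, 0 ≤ α k)
    (C : ∀ i, Fin (m i) → Prop) (hC : ∀ i, ∃ x, C i x)
    (hcl : ∀ i s t, C i s → 0 < α ⟨i, s, t⟩ → C i t) :
    ∃ p : ∀ i, Fin (m i) → ℝ, (∀ i s, 0 ≤ p i s) ∧ (∀ i, ∑ s, p i s = 1) ∧
      (∀ i s, ¬ C i s → p i s = 0) ∧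
      ∀ i t, ∑ s, p i s * α ⟨i, s, t⟩ = p i t * ∑ u, α ⟨i, t, u⟩ := by
  have := fun i => invariant_exists (fun s t => α ⟨i, s, t⟩) (fun s t => hα _) (C i) (hC i) (hcl i)
  choose p h1 h2 h3 h4 using this
  exact ⟨p, h1, h2, h3, h4⟩

theorem exists_corrEq {n : ℕ} {m : Fin n → ℕ} (hm : ∀ i, 0 < m i) (G : Game m) :
    ∃ μ, IsCorrEq G μ := by
  by_contra hno
  obtain ⟨α, hα, hg⟩ := farkas_nn (gc G) (fun _ => -1) (by
    intro x hx hA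
    by_contra hneg
    have hpos : 0 < ∑ s, x s := by
      simp only [mul_neg, mul_one, Finset.sum_neg_distrib] at hneg
      linarith
    refine hno ⟨fun s => x s / ∑ s, x s, (isCorrEq_iff _ _).2
      ⟨fun s => div_nonneg (hx s) hpos.le, ?_, fun k => ?_⟩⟩
    · rw [← Finset.sum_div, div_self hpos.ne']
    · simp only [div_mul_eq_mul_div]
      rw [← Finset.sum_div]
      exact div_nonneg (hA k) hpos.le)
  obtain ⟨p, hp0, hp1, -, hp⟩ := inv_family α hα (fun _ _ => True) (fun i => ⟨⟨0, hm i⟩, trivial⟩)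
    (fun _ _ _ _ _ => trivial)
  have h1 := hs_lemma G α p hp
  have h2 := sum_prod_one p hp1
  have h3 : ∑ s : Strat m, (∏ i, p i (s i)) * ∑ k, α k * gc G k s
      ≤ ∑ s : Strat m, (∏ i, p i (s i)) * (-1) :=
    Finset.sum_le_sum fun s _ => mul_le_mul_of_nonneg_left (hg s)
      (Finset.prod_nonneg fun i _ => hp0 i _)
  rw [← Finset.sum_mul, h2, h1] at h3
  linarith

theorem sum_swap {n : ℕ} {m : Fin n → ℕ} (G : Game m) (α : Dev m → ℝ) (μ : Strat m → ℝ) :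
    ∑ s, μ s * ∑ k, α k * gc G k s = ∑ k, α k * ∑ s, μ s * gc G k s := by
  simp only [Finset.mul_sum]
  rw [Finset.sum_comm]
  exact Finset.sum_congr rfl fun k _ => Finset.sum_congr rfl fun s _ => by ring

/-- Strict complementarity. -/
theorem tucker {n : ℕ} {m : Fin n → ℕ} (G : Game m) (σ : Strat m → ℝ)
    (hσ : IsCorrEq G σ) (huniq : ∀ μ, IsCorrEq G μ → μ = σ) :
    ∃ α : Dev m → ℝ, (∀ k, 0 ≤ α k) ∧ (∀ s, ∑ k, α k * gc G k s ≤ 0) ∧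
      (∀ s, σ s = 0 → ∑ k, α k * gc G k s < 0) ∧ (∀ s, σ s ≠ 0 → ∑ k, α k * gc G k s = 0) ∧
      (∀ k, ∑ s, σ s * gc G k s = 0 → 0 < α k) ∧ (∀ k, ∑ s, σ s * gc G k s ≠ 0 → α k = 0) := by
  classical
  obtain ⟨hσ0, hσ1, hσk⟩ := (isCorrEq_iff _ _).1 hσ
  have cone : ∀ x : Strat m → ℝ, (∀ s, 0 ≤ x s) → (∀ k, 0 ≤ ∑ s, x s * gc G k s) →
      ∃ c : ℝ, ∀ s, x s = c * σ s := by
    intro x hx hA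
    rcases (Finset.sum_nonneg fun s _ => hx s : 0 ≤ ∑ s, x s).eq_or_lt with h | hpos
    · refine ⟨0, fun s => ?_⟩
      rw [zero_mul]
      exact (Finset.sum_eq_zero_iff_of_nonneg fun s _ => hx s).1 h.symm s (Finset.mem_univ s)
    · have := huniq (fun s => x s / ∑ s, x s) ((isCorrEq_iff _ _).2
        ⟨fun s => div_nonneg (hx s) hpos.le, by rw [← Finset.sum_div, div_self hpos.ne'],
          fun k => by
            simp only [div_mul_eq_mul_div]
            rw [← Finset.sum_div]
            exact div_nonneg (hA k) hpos.le⟩)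
      refine ⟨∑ s, x s, fun s => ?_⟩
      rw [← this]; field_simp
  have h1 : ∀ s0, ∃ α : Dev m → ℝ, (∀ k, 0 ≤ α k) ∧ (∀ s, ∑ k, α k * gc G k s ≤ 0) ∧
      (σ s0 = 0 → ∑ k, α k * gc G k s0 < 0) := by
    intro s0
    by_cases h0 : σ s0 = 0
    · obtain ⟨α, hα, hg⟩ := farkas_nn (gc G) (fun s => if s = s0 then -1 else 0) (by
        intro x hx hA
        obtain ⟨c, hc⟩ := cone x hx hA
        simp [hc, h0])
      refine ⟨α, hα, fun s => (hg s).trans ?_, fun _ => (hg s0).trans_lt (by simp)⟩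
      split_ifs <;> norm_num
    · exact ⟨0, fun _ => le_rfl, fun s => by simp, fun h => absurd h h0⟩
  have h2 : ∀ k0, ∃ α : Dev m → ℝ, (∀ k, 0 ≤ α k) ∧ (∀ s, ∑ k, α k * gc G k s ≤ 0) ∧
      (∑ s, σ s * gc G k0 s = 0 → 0 < α k0) := by
    intro k0
    by_cases h0 : ∑ s, σ s * gc G k0 s = 0
    · obtain ⟨α, hα, hg⟩ := farkas_nn (gc G) (fun s => - gc G k0 s) (by
        intro x hx hA
        obtain ⟨c, hc⟩ := cone x hx hA
        simp [hc, mul_assoc, ← Finset.mul_sum, h0])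
      refine ⟨fun k => α k + if k = k0 then 1 else 0, fun k => ?_, fun s => ?_, fun _ => ?_⟩
      · have := hα k
        dsimp only; split_ifs <;> linarith
      · have := hg s
        simp [add_mul, Finset.sum_add_distrib]
        linarith
      · have := hα k0
        simp; linarith
    · exact ⟨0, fun _ => le_rfl, fun s => by simp, fun h => absurd h h0⟩
  choose α1 hα1 hg1 hp1 using h1
  choose α2 hα2 hg2 hp2 using h2
  let α : Dev m → ℝ := fun k => ∑ s0, α1 s0 k + ∑ k0, α2 k0 k
  have hg : ∀ s, ∑ k, α k * gc G k s
      = ∑ s0, ∑ k, α1 s0 k * gc G k s + ∑ k0, ∑ k, α2 k0 k * gc G k s := by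
    intro s
    simp only [α, add_mul, Finset.sum_add_distrib, Finset.sum_mul]
    congr 1 <;> exact Finset.sum_comm
  have hα : ∀ k, 0 ≤ α k := fun k => add_nonneg (Finset.sum_nonneg fun s _ => hα1 s k)
    (Finset.sum_nonneg fun s _ => hα2 s k)
  have hneg : ∀ s, ∑ k, α k * gc G k s ≤ 0 := fun s => by
    rw [hg]
    exact add_nonpos (Finset.sum_nonpos fun s0 _ => hg1 s0 s) (Finset.sum_nonpos fun s0 _ => hg2 s0 s)
  have e1 := sum_swap G α σ
  have e2 : ∑ s, σ s * ∑ k, α k * gc G k s ≤ 0 := Finset.sum_nonpos fun s _ =>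
    mul_nonpos_of_nonneg_of_nonpos (hσ0 s) (hneg s)
  have e3 : 0 ≤ ∑ k, α k * ∑ s, σ s * gc G k s := Finset.sum_nonneg fun k _ =>
    mul_nonneg (hα k) (hσk k)
  refine ⟨α, hα, hneg, fun s hs => ?_, fun s hs => ?_, fun k hk => ?_, fun k hk => ?_⟩
  · rw [hg]
    refine add_neg_of_neg_of_nonpos ?_ (Finset.sum_nonpos fun s0 _ => hg2 s0 s)
    refine Finset.sum_neg' (fun s0 _ => hg1 s0 s) ⟨s, Finset.mem_univ _, hp1 s hs⟩
  · have := (Finset.sum_eq_zero_iff_of_nonpos fun s _ =>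
      mul_nonpos_of_nonneg_of_nonpos (hσ0 s) (hneg s)).1 (le_antisymm e2 (e1 ▸ e3)) s
      (Finset.mem_univ s)
    exact (mul_eq_zero.1 this).resolve_left hs
  · refine add_pos_of_nonneg_of_pos (Finset.sum_nonneg fun s _ => hα1 s k) ?_
    exact Finset.sum_pos' (fun k0 _ => hα2 k0 k) ⟨k, Finset.mem_univ _, hp2 k hk⟩
  · have := (Finset.sum_eq_zero_iff_of_nonneg fun k _ =>
      mul_nonneg (hα k) (hσk k)).1 (le_antisymm (e1 ▸ e2) e3) k (Finset.mem_univ k)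
    exact (mul_eq_zero.1 this).resolve_right hk

/-- if a finite `n`-player game `G` has a unique correlated equilibrium `σ`,
then there is a neighborhood of `G` in which every game has a unique correlated equilibrium,
with the same support as `σ`. -/
theorem statement1 {n : ℕ} (m : Fin n → ℕ) (hm : ∀ i, 0 < m i) (G : Game m)
    (σ : Strat m → ℝ) (hσ : IsCorrEq G σ) (huniq : ∀ μ, IsCorrEq G μ → μ = σ) :
    ∃ U ∈ nhds G, ∀ G' ∈ U, ∃ μ : Strat m → ℝ, IsCorrEq G' μ ∧
      (∀ ν, IsCorrEq G' ν → ν = μ) ∧ {s | 0 < μ s} = {s | 0 < σ s} := by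
  classical
  obtain ⟨hσ0, hσ1, hσk⟩ := (isCorrEq_iff _ _).1 hσ
  obtain ⟨α, hα, hg, hgneg, hgz, hαpos, hαz⟩ := tucker G σ hσ huniq
  let P : Dev m → Prop := fun k => ∑ s, σ s * gc G k s = 0
  have hgc : ∀ k s, Continuous (fun G' : Game m => gc G' k s) := by
    intro k s
    unfold gc
    split_ifs
    · fun_prop
    · exact continuous_const
  let A : Game m → Matrix (Dev m ⊕ Strat m ⊕ Unit) (Strat m) ℝ := fun G' j s =>
    Sum.elim (fun k => if P k then gc G' k s else 0)
      (Sum.elim (fun t => if σ t = 0 ∧ t = s then 1 else 0) (fun _ => 1)) j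
  have hAcont : Continuous A := by
    refine continuous_matrix fun j s => ?_
    rcases j with k | t | u
    · simp only [A, Sum.elim_inl]
      split_ifs
      · exact hgc k s
      · exact continuous_const
    · exact continuous_const
    · exact continuous_const
  have hAk : ∀ G' x k, P k → (A G').mulVec x (Sum.inl k) = ∑ s, x s * gc G' k s := by
    intro G' x k hk
    simp only [Matrix.mulVec, dotProduct, A, Sum.elim_inl, if_pos hk]
    exact Finset.sum_congr rfl fun s _ => mul_comm _ _
  have hAk' : ∀ G' x k, ¬ P k → (A G').mulVec x (Sum.inl k) = 0 := by
    intro G' x k hk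
    simp [Matrix.mulVec, dotProduct, A, if_neg hk]
  have hAt : ∀ G' x t, σ t = 0 → (A G').mulVec x (Sum.inr (Sum.inl t)) = x t := by
    intro G' x t ht
    simp [Matrix.mulVec, dotProduct, A, ht]
  have hAt' : ∀ G' x t, σ t ≠ 0 → (A G').mulVec x (Sum.inr (Sum.inl t)) = 0 := by
    intro G' x t ht
    simp [Matrix.mulVec, dotProduct, A, ht]
  have hAu : ∀ G' x u, (A G').mulVec x (Sum.inr (Sum.inr u)) = ∑ s, x s := by
    intro G' x u
    simp [Matrix.mulVec, dotProduct, A]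
  have hinj : ∀ x, (A G).mulVec x = 0 → x = 0 := by
    intro x hx
    have h1 : ∀ k, P k → ∑ s, x s * gc G k s = 0 := fun k hk => by
      rw [← hAk G x k hk, hx]; rfl
    have h2 : ∀ t, σ t = 0 → x t = 0 := fun t ht => by rw [← hAt G x t ht, hx]; rfl
    have h3 : ∑ s, x s = 0 := by rw [← hAu G x (), hx]; rfl
    have c1 : ∀ᶠ ε : ℝ in nhds 0, ∀ s, 0 ≤ σ s + ε * x s := by
      refine Filter.eventually_all.2 fun s => ?_
      by_cases hs : σ s = 0
      · simp [hs, h2 s hs]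
      · have : ContinuousAt (fun ε : ℝ => σ s + ε * x s) 0 := by fun_prop
        filter_upwards [this.eventually_const_lt
          (show (0 : ℝ) < σ s + 0 * x s by
            rw [zero_mul, add_zero]; exact lt_of_le_of_ne (hσ0 s) (Ne.symm hs))] with ε h
        exact h.le
    have c2 : ∀ᶠ ε : ℝ in nhds 0, ∀ k, 0 ≤ ∑ s, σ s * gc G k s + ε * ∑ s, x s * gc G k s := by
      refine Filter.eventually_all.2 fun k => ?_
      by_cases hk : P k
      · have hk' : ∑ s, σ s * gc G k s = 0 := hk
        simp [hk', h1 k hk]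
      · have : ContinuousAt (fun ε : ℝ => ∑ s, σ s * gc G k s + ε * ∑ s, x s * gc G k s) 0 := by
          fun_prop
        filter_upwards [this.eventually_const_lt
          (show (0 : ℝ) < ∑ s, σ s * gc G k s + 0 * ∑ s, x s * gc G k s by
            rw [zero_mul, add_zero]; exact lt_of_le_of_ne (hσk k) (Ne.symm hk))] with ε h
        exact h.le
    have c3 : ∃ᶠ ε : ℝ in nhds 0, 0 < ε :=
      (Filter.frequently_iff.2 fun {U} hU => by
        obtain ⟨δ, hδ, hU⟩ := Metric.mem_nhds_iff.1 hU
        exact ⟨δ / 2, hU (by simp [abs_of_pos hδ, hδ]), by positivity⟩)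
    obtain ⟨ε, hε, e1, e2⟩ := (c3.and_eventually (c1.and c2)).exists
    have := huniq (fun s => σ s + ε * x s) ((isCorrEq_iff _ _).2 ⟨e1, by
      rw [Finset.sum_add_distrib, ← Finset.mul_sum, h3, hσ1]; simp, fun k => by
        have := e2 k
        rw [Finset.mul_sum, ← Finset.sum_add_distrib] at this
        refine this.trans_eq (Finset.sum_congr rfl fun s _ => by ring)⟩)
    ext s
    have := congrFun this s
    simpa [hε.ne'] using this
  obtain ⟨hsolve, huni⟩ := perturb A hAcont G hinj
  obtain ⟨v, hvc, hv0, hv⟩ := hsolve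
    (fun G' s => ∑ k, α k * gc G k s - ∑ k, α k * gc G' k s) (by
      refine continuous_pi fun s => ?_
      refine continuous_const.sub (continuous_finsetSum _ fun k _ => continuous_const.mul (hgc k s)))
    (by ext s; simp)
  let e : Dev m ⊕ Strat m ⊕ Unit → ℝ := Sum.elim (fun _ => 0) (Sum.elim (fun _ => 0) (fun _ => 1))
  obtain ⟨F, hFc, hF⟩ := huni e
  -- a solution of the support equations satisfies `A x = e`
  have hAe : ∀ G' x, (∀ k, P k → ∑ s, x s * gc G' k s = 0) → (∀ t, σ t = 0 → x t = 0) →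
      ∑ s, x s = 1 → (A G').mulVec x = e := by
    intro G' x h1 h2 h3
    ext j
    rcases j with k | t | u
    · by_cases hk : P k
      · rw [hAk G' x k hk, h1 k hk]; rfl
      · rw [hAk' G' x k hk]; rfl
    · by_cases ht : σ t = 0
      · rw [hAt G' x t ht, h2 t ht]; rfl
      · rw [hAt' G' x t ht]; rfl
    · rw [hAu, h3]; rfl
  have hFG : F G = σ := (hF.self_of_nhds σ (hAe G σ (fun k hk => hk) (fun t ht => ht) hσ1)).symm
  have hFpos : ∀ᶠ G' in nhds G, ∀ s, σ s ≠ 0 → 0 < F G' s := by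
    refine Filter.eventually_all.2 fun s => ?_
    by_cases hs : σ s = 0
    · simp [hs]
    · have hc : ContinuousAt (fun G' => F G' s) G := (continuous_apply s).continuousAt.comp hFc
      filter_upwards [hc.eventually_const_lt (show 0 < F G s by
        rw [hFG]; exact lt_of_le_of_ne (hσ0 s) (Ne.symm hs))] with G' h _
      exact h
  have hvj : ∀ j, ContinuousAt (fun G' => v G' j) G := fun j =>
    (continuous_apply j).continuousAt.comp hvc
  have hvk : ∀ᶠ G' in nhds G, ∀ k, P k → 0 < α k + v G' (Sum.inl k) := by
    refine Filter.eventually_all.2 fun k => ?_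
    by_cases hk : P k
    · filter_upwards [(continuousAt_const.add (hvj (Sum.inl k))).eventually_const_lt
        (show 0 < α k + v G (Sum.inl k) by rw [hv0]; simpa using hαpos k hk)] with G' h _
      exact h
    · simp [hk]
  have hvt : ∀ᶠ G' in nhds G, ∀ t, σ t = 0 →
      0 < -(∑ k, α k * gc G k t) + v G' (Sum.inr (Sum.inl t)) := by
    refine Filter.eventually_all.2 fun t => ?_
    by_cases ht : σ t = 0
    · filter_upwards [(continuousAt_const.add (hvj (Sum.inr (Sum.inl t)))).eventually_const_lt
        (show 0 < -(∑ k, α k * gc G k t) + v G (Sum.inr (Sum.inl t)) by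
          rw [hv0]; simpa using hgneg t ht)] with G' h _
      exact h
    · simp [ht]
  -- the closed sets on which invariant distributions live
  obtain ⟨p, hp0, hp1, -, hp⟩ := inv_family α hα (fun _ _ => True) (fun i => ⟨⟨0, hm i⟩, trivial⟩)
    (fun _ _ _ _ _ => trivial)
  let C : ∀ i, Fin (m i) → Prop := fun i s => p i s ≠ 0
  have hCne : ∀ i, ∃ x, C i x := by
    intro i
    by_contra hno
    push Not at hno
    have h1 := hp1 i
    rw [Finset.sum_eq_zero fun s _ => not_not.1 (hno s)] at h1
    exact zero_ne_one h1
  have hCcl : ∀ i s t, C i s → 0 < α ⟨i, s, t⟩ → C i t := by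
    intro i s t hs hst h0
    have h1 := hp i t
    rw [h0, zero_mul] at h1
    have h2 := (Finset.sum_eq_zero_iff_of_nonneg fun s _ => mul_nonneg (hp0 i s) (hα _)).1 h1 s
      (Finset.mem_univ s)
    exact (mul_ne_zero hs hst.ne') h2
  have hCσ : ∀ s : Strat m, (∀ i, C i (s i)) → σ s ≠ 0 := by
    intro s hs h0
    have h1 := hs_lemma G α p hp
    have h2 := (Finset.sum_eq_zero_iff_of_nonpos fun s _ => mul_nonpos_of_nonneg_of_nonpos
      (Finset.prod_nonneg fun i _ => hp0 i (s i)) (hg s)).1 h1 s (Finset.mem_univ s)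
    exact (mul_ne_zero (Finset.prod_ne_zero_iff.2 fun i _ => hs i) (hgneg s h0).ne) h2
  refine ⟨_, hv.and (hF.and (hFpos.and (hvk.and hvt))), ?_⟩
  rintro G' ⟨hv', hF', hFpos', hvk', hvt'⟩
  let α' : Dev m → ℝ := fun k => if P k then α k + v G' (Sum.inl k) else 0
  let β' : Strat m → ℝ := fun t =>
    if σ t = 0 then -(∑ k, α k * gc G k t) + v G' (Sum.inr (Sum.inl t)) else 0
  let c : ℝ := v G' (Sum.inr (Sum.inr ()))
  have hα' : ∀ k, 0 ≤ α' k := by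
    intro k
    simp only [α']
    split_ifs with hk
    · exact (hvk' k hk).le
    · exact le_rfl
  have hα'P : ∀ k, 0 < α' k → 0 < α k := by
    intro k hk
    by_cases h : P k
    · exact hαpos k h
    · simp [α', h] at hk
  have hβ' : ∀ t, 0 ≤ β' t := by
    intro t
    simp only [β']
    split_ifs with ht
    · exact (hvt' t ht).le
    · exact le_rfl
  have hkey : ∀ s, ∑ k, α' k * gc G' k s = - c - β' s := by
    intro s
    have h1 := congrFun hv' s
    simp only [Matrix.vecMul, dotProduct, Fintype.sum_sum_type, A, Sum.elim_inl, Sum.elim_inr,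
      Finset.univ_unique, Finset.sum_singleton, mul_one] at h1
    have h2 : ∑ k, α' k * gc G' k s
        = ∑ k, α k * gc G' k s + ∑ k, v G' (Sum.inl k) * (if P k then gc G' k s else 0) := by
      rw [← Finset.sum_add_distrib]
      refine Finset.sum_congr rfl fun k _ => ?_
      by_cases hk : P k
      · simp only [α', if_pos hk]; ring
      · simp [α', if_neg hk, hαz k hk]
    have h3 : ∑ t, v G' (Sum.inr (Sum.inl t)) * (if σ t = 0 ∧ t = s then (1 : ℝ) else 0)
        = if σ s = 0 then v G' (Sum.inr (Sum.inl s)) else 0 := by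
      rw [Finset.sum_eq_single s]
      · simp
      · intro b _ hb; simp [hb]
      · simp
    have h4 : β' s = -(∑ k, α k * gc G k s) + if σ s = 0 then v G' (Sum.inr (Sum.inl s)) else 0 := by
      by_cases hs : σ s = 0
      · simp only [β', if_pos hs]
      · simp [β', if_neg hs, hgz s hs]
    have h5 : v G' (Sum.inr (Sum.inr default)) = c := rfl
    rw [h3, h5] at h1
    rw [h2, h4]
    linarith
  have hc : c = 0 := by
    obtain ⟨q, hq0, hq1, hqC, hq⟩ := inv_family α' hα' C hCne
      (fun i s t hs hst => hCcl i s t hs (hα'P _ hst))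
    have h1 := hs_lemma G' α' q hq
    have h2 := sum_prod_one q hq1
    have h3 : ∑ s : Strat m, (∏ i, q i (s i)) * ∑ k, α' k * gc G' k s
        = ∑ s : Strat m, (∏ i, q i (s i)) * (-c) := by
      refine Finset.sum_congr rfl fun s _ => ?_
      by_cases hs : ∀ i, C i (s i)
      · have : β' s = 0 := by simp [β', hCσ s hs]
        rw [hkey, this, sub_zero]
      · push Not at hs
        obtain ⟨i, hi⟩ := hs
        rw [Finset.prod_eq_zero (Finset.mem_univ i) (hqC i _ hi)]
        simp
    rw [h3, ← Finset.sum_mul, h2] at h1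
    linarith
  have huniq' : ∀ ν, IsCorrEq G' ν → ν = F G' ∧ ∀ t, σ t = 0 → ν t = 0 := by
    intro ν hν
    obtain ⟨hν0, hν1, hνk⟩ := (isCorrEq_iff _ _).1 hν
    have e1 := sum_swap G' α' ν
    have e2 : ∀ s, ν s * ∑ k, α' k * gc G' k s ≤ 0 := fun s => by
      rw [hkey, hc]
      exact mul_nonpos_of_nonneg_of_nonpos (hν0 s) (by have := hβ' s; linarith)
    have e3 : ∀ k, 0 ≤ α' k * ∑ s, ν s * gc G' k s := fun k => mul_nonneg (hα' k) (hνk k)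
    have e4 : ∑ s, ν s * ∑ k, α' k * gc G' k s ≤ 0 := Finset.sum_nonpos fun s _ => e2 s
    have e5 : 0 ≤ ∑ k, α' k * ∑ s, ν s * gc G' k s := Finset.sum_nonneg fun k _ => e3 k
    have h1 : ∀ t, σ t = 0 → ν t = 0 := by
      intro t ht
      have := (Finset.sum_eq_zero_iff_of_nonpos fun s _ => e2 s).1
        (le_antisymm e4 (e1 ▸ e5)) t (Finset.mem_univ t)
      refine (mul_eq_zero.1 this).resolve_right ?_
      rw [hkey, hc]
      have h2 := hvt' t ht
      have h3 : β' t = -(∑ k, α k * gc G k t) + v G' (Sum.inr (Sum.inl t)) := if_pos ht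
      rw [← h3] at h2
      linarith
    have h2 : ∀ k, P k → ∑ s, ν s * gc G' k s = 0 := by
      intro k hk
      have := (Finset.sum_eq_zero_iff_of_nonneg fun k _ => e3 k).1
        (le_antisymm (e1 ▸ e4) e5) k (Finset.mem_univ k)
      refine (mul_eq_zero.1 this).resolve_left ?_
      simp only [α', if_pos hk]
      exact (hvk' k hk).ne'
    exact ⟨hF' ν (hAe G' ν h2 h1 hν1), h1⟩
  obtain ⟨μ, hμ⟩ := exists_corrEq hm G'
  obtain ⟨hμF, hμ0⟩ := huniq' μ hμ
  refine ⟨μ, hμ, fun ν hν => (huniq' ν hν).1.trans hμF.symm, ?_⟩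
  ext s
  simp only [Set.mem_setOf_eq]
  constructor
  · intro h
    refine lt_of_le_of_ne (hσ0 s) fun h0 => ?_
    rw [hμ0 s h0.symm] at h
    exact lt_irrefl _ h
  · intro h
    rw [hμF]
    exact hFpos' s h.ne'
end

section
/- Consider the three-player game in which player 1 chooses a row in {T,B}, player 2 a column in {L,R}, player 3 a matrix in {W,E}, and payoffs (U^1,U^2,U^3) are: (T,L,W) ↦ (1,1,1), (T,R,W) ↦ (0,1,1), (B,L,W) ↦ (1,1,0), (B,R,W) ↦ (1,0,1), (T,L,E) ↦ (1,0,1), (T,R,E) ↦ (1,1,0), (B,L,E) ↦ (0,1,1), (B,R,E) ↦ (0,0,0). This game has a unique Nash equilibrium, namely the pure profile (T,L,W), and this unique Nash equilibrium is not quasi-strict. -/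
/-- The Dirac (pure) mixed strategy concentrated on `a`. -/
def pureStrat {k : ℕ} (a : Fin k) : Fin k → ℝ := fun b => if b = a then 1 else 0

/-- A mixed strategy profile: each player plays a probability distribution
on her pure strategies. -/
def IsMixedProfile {n : ℕ} {m : Fin n → ℕ} (σ : ∀ i, Fin (m i) → ℝ) : Prop :=
  ∀ i, (∀ a, 0 ≤ σ i a) ∧ ∑ a, σ i a = 1

/-- Multilinear extension of player `i`'s payoff to mixed strategy profiles. -/
def mixedPayoff {n : ℕ} {m : Fin n → ℕ} (G : Game m) (i : Fin n)
    (σ : ∀ j, Fin (m j) → ℝ) : ℝ :=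
  ∑ s : Strat m, (∏ j, σ j (s j)) * G i s

/-- Player `i`'s payoff when deviating to the pure strategy `t`, the others
keeping their strategies in `σ`: this is `Uⁱ(t, σ⁻ⁱ)`. -/
def devPayoff {n : ℕ} {m : Fin n → ℕ} (G : Game m) (i : Fin n)
    (σ : ∀ j, Fin (m j) → ℝ) (t : Fin (m i)) : ℝ :=
  mixedPayoff G i (Function.update σ i (pureStrat t))

/-- Nash equilibrium: no player gains by a unilateral pure deviation. -/
def IsNash {n : ℕ} {m : Fin n → ℕ} (G : Game m) (σ : ∀ i, Fin (m i) → ℝ) : Prop :=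
  IsMixedProfile σ ∧ ∀ (i : Fin n) (t : Fin (m i)), devPayoff G i σ t ≤ mixedPayoff G i σ

/-- Quasi-strictness: for every player `i`, every pure best response to `σ⁻ⁱ`
belongs to the support of `σ i`. -/
def IsQuasiStrict {n : ℕ} {m : Fin n → ℕ} (G : Game m) (σ : ∀ i, Fin (m i) → ℝ) : Prop :=
  ∀ (i : Fin n) (t : Fin (m i)),
    (∀ t' : Fin (m i), devPayoff G i σ t' ≤ devPayoff G i σ t) → 0 < σ i t

/-- The payoff table of the three-player game: `eilTbl r c w` is the payoff vector
`(U¹, U², U³)` when player 1 plays row `r` (`0` = T, `1` = B), player 2 plays column `c`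
(`0` = L, `1` = R) and player 3 plays matrix `w` (`0` = W, `1` = E):
`(T,L,W) ↦ (1,1,1)`, `(T,R,W) ↦ (0,1,1)`, `(B,L,W) ↦ (1,1,0)`, `(B,R,W) ↦ (1,0,1)`,
`(T,L,E) ↦ (1,0,1)`, `(T,R,E) ↦ (1,1,0)`, `(B,L,E) ↦ (0,1,1)`, `(B,R,E) ↦ (0,0,0)`. -/
def eilTbl : Fin 2 → Fin 2 → Fin 2 → Fin 3 → ℝ :=
  ![![![![1, 1, 1], ![1, 0, 1]], ![![0, 1, 1], ![1, 1, 0]]],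
    ![![![1, 1, 0], ![0, 1, 1]], ![![1, 0, 1], ![0, 0, 0]]]]

/-- The three-player `2 × 2 × 2` game with the above payoffs. -/
def eilGame : Game (fun _ : Fin 3 => 2) := fun i s => eilTbl (s 0) (s 1) (s 2) i

/-- The pure profile `(T, L, W)`: every player plays her first strategy. -/
def eilEq : ∀ j : Fin 3, Fin ((fun _ : Fin 3 => 2) j) → ℝ := fun _ => pureStrat 0

def tripEquiv : Strat (fun _ : Fin 3 => 2) ≃ Fin 2 × Fin 2 × Fin 2 where
  toFun s := (s 0, s 1, s 2)
  invFun p := ![p.1, p.2.1, p.2.2]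
  left_inv s := by
    funext i
    fin_cases i <;> rfl
  right_inv p := rfl

lemma payoff_eq (i : Fin 3) (σ : ∀ j : Fin 3, Fin ((fun _ : Fin 3 => 2) j) → ℝ) :
    mixedPayoff eilGame i σ =
      ∑ a : Fin 2, ∑ b : Fin 2, ∑ c : Fin 2, σ 0 a * σ 1 b * σ 2 c * eilTbl a b c i := by
  unfold mixedPayoff
  rw [Fintype.sum_equiv tripEquiv _
    (fun p => σ 0 p.1 * σ 1 p.2.1 * σ 2 p.2.2 * eilTbl p.1 p.2.1 p.2.2 i)]
  · simp only [Fintype.sum_prod_type]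
  · intro s
    rw [Fin.prod_univ_three]
    rfl

/-- Core real-arithmetic argument. -/
lemma core (x y z : ℝ) (hx : 0 ≤ x) (hy : 0 ≤ y) (hz : 0 ≤ z)
    (a1 : x * (z - y + y * z) ≤ 0) (a2 : 0 ≤ (1 - x) * (z - y + y * z))
    (b1 : y * (x - z + x * z) ≤ 0) (b2 : 0 ≤ (1 - y) * (x - z + x * z))
    (c1 : z * (y - x + x * y) ≤ 0) (c2 : 0 ≤ (1 - z) * (y - x + x * y)) :
    x = 0 ∧ y = 0 ∧ z = 0 := by
  rcases hx.eq_or_lt with rfl | hx'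
  · have : z = 0 := by
      by_contra h
      have hz' : 0 < z := lt_of_le_of_ne hz (Ne.symm h)
      have : y = 0 := by nlinarith
      subst this
      nlinarith
    subst this
    refine ⟨rfl, ?_, rfl⟩
    nlinarith
  rcases hy.eq_or_lt with rfl | hy'
  · have : z = 1 := by nlinarith
    subst this
    nlinarith
  rcases hz.eq_or_lt with rfl | hz'
  · nlinarith
  have h1 : z - y + y * z ≤ 0 := by
    by_contra h
    nlinarith [mul_pos hx' (not_le.mp h)]
  have h2 : x - z + x * z ≤ 0 := by
    by_contra h
    nlinarith [mul_pos hy' (not_le.mp h)]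
  have h3 : y - x + x * y ≤ 0 := by
    by_contra h
    nlinarith [mul_pos hz' (not_le.mp h)]
  nlinarith [mul_pos hx' hy', mul_pos hy' hz', mul_pos hx' hz']

/-- the above game has a unique Nash equilibrium, namely the pure profile
`(T, L, W)`, and this unique Nash equilibrium is not quasi-strict. -/
theorem statement12 :
    IsNash eilGame eilEq ∧ (∀ τ, IsNash eilGame τ → τ = eilEq) ∧
      ¬ IsQuasiStrict eilGame eilEq := by
  refine ⟨⟨?_, ?_⟩, ?_, ?_⟩
  · intro i
    refine ⟨fun a => ?_, ?_⟩
    · simp only [eilEq, pureStrat]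
      split_ifs <;> norm_num
    · simp [eilEq, pureStrat]
  · intro i t
    unfold devPayoff
    rw [payoff_eq, payoff_eq]
    fin_cases i <;> fin_cases t <;>
      simp [Fin.sum_univ_two, eilTbl, eilEq, pureStrat, Function.update]
  · rintro τ ⟨hm, hn⟩
    have key : ∀ i t, mixedPayoff eilGame i (Function.update τ i (pureStrat t))
      ≤ mixedPayoff eilGame i τ := hn
    have e00 := key 0 0
    have e01 := key 0 1
    have e10 := key 1 0
    have e11 := key 1 1
    have e20 := key 2 0
    have e21 := key 2 1
    have n0 := (hm 0).1 1
    have n1 := (hm 1).1 1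
    have n2 := (hm 2).1 1
    have s0 : τ 0 0 + τ 0 1 = 1 := by simpa [Fin.sum_univ_two] using (hm 0).2
    have s1 : τ 1 0 + τ 1 1 = 1 := by simpa [Fin.sum_univ_two] using (hm 1).2
    have s2 : τ 2 0 + τ 2 1 = 1 := by simpa [Fin.sum_univ_two] using (hm 2).2
    have t0 : τ 0 0 = 1 - τ 0 1 := by linarith
    have t1 : τ 1 0 = 1 - τ 1 1 := by linarith
    have t2 : τ 2 0 = 1 - τ 2 1 := by linarith
    rw [payoff_eq, payoff_eq] at e00 e01 e10 e11 e20 e21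
    simp [Fin.sum_univ_two, eilTbl, pureStrat, Function.update, t0, t1, t2]
      at e00 e01 e10 e11 e20 e21
    obtain ⟨hx, hy, hz⟩ := core (τ 0 1) (τ 1 1) (τ 2 1) n0 n1 n2
      (by linarith) (by linarith) (by linarith) (by linarith) (by linarith) (by linarith)
    rw [hx] at t0
    rw [hy] at t1
    rw [hz] at t2
    funext i a
    fin_cases i <;> fin_cases a <;> simp [eilEq, pureStrat, *]
  · intro h
    have := h 0 1 (by
      intro t
      unfold devPayoff
      rw [payoff_eq, payoff_eq]
      fin_cases t <;>
        simp [Fin.sum_univ_two, eilTbl, eilEq, pureStrat, Function.update])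
    simp [eilEq, pureStrat] at this
end
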